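/- Let Φ be an N-function such that Φ and its complementary function Φ* satisfy the Δ₂-condition, and let ω be a weight on ℝ^d. Then the following statements are equivalent: (1) ω belongs to the class A_Φ; (2) ω belongs to the Muckenhoupt class A_{i(Φ)}, where i(Φ) is the lower index of Φ (under the stated assumptions 1 < i(Φ) < ∞); (3) there is a constant C > 0 such that ∫_{ℝ^d} Φ(Mv(x))ω(x)dx ≤ C ∫_{ℝ^d} Φ(|v(x)|)ω(x)dx for every measurable v with ∫_{ℝ^d} Φ(|v|)ω dx < ∞, where M is the Hardy–Littlewood maximal operator. -/

import Mathlib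

open MeasureTheory Metric Filter
open scoped ENNReal InnerProductSpace

noncomputable section

structure NFunction where
  der : ℝ → ℝ
  der_nonneg : ∀ s, 0 ≤ der s
  der_zero : der 0 = 0
  der_pos : ∀ s, 0 < s → 0 < der s
  der_mono : MonotoneOn der (Set.Ici 0)
  der_rightCont : ∀ s, 0 ≤ s → ContinuousWithinAt der (Set.Ici s) s
  der_tendsto : Tendsto der atTop atTop

def NFunction.toFun (Φ : NFunction) (t : ℝ) : ℝ := ∫ s in (0:ℝ)..t, Φ.der s

def NFunction.invDer (Φ : NFunction) (t : ℝ) : ℝ := sSup {s : ℝ | 0 ≤ s ∧ Φ.der s ≤ t}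

def NFunction.conj (Φ : NFunction) (t : ℝ) : ℝ := ∫ s in (0:ℝ)..t, Φ.invDer s

def IsWeight {n : ℕ} (ω : EuclideanSpace ℝ (Fin n) → ℝ) : Prop :=
  MeasureTheory.LocallyIntegrable ω volume ∧ ∀ᵐ x ∂(volume : Measure (EuclideanSpace ℝ (Fin n))), 0 < ω x

def Delta2On (f : ℝ → ℝ) : Prop := ∃ K > 0, ∀ t ≥ (0:ℝ), f (2 * t) ≤ K * f t

def NFunction.lowerIndex (Φ : NFunction) : ℝ :=
  limUnder (nhdsWithin 0 (Set.Ioi 0)) (fun lam : ℝ =>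
    Real.log (sSup {r : ℝ | ∃ t > 0, r = Φ.toFun (lam * t) / Φ.toFun t}) / Real.log lam)

def NFunction.derE (Φ : NFunction) : ℝ≥0∞ → ℝ≥0∞ :=
  fun t => if t = ⊤ then ⊤ else ENNReal.ofReal (Φ.der t.toReal)

def NFunction.toFunE (Φ : NFunction) : ℝ≥0∞ → ℝ≥0∞ :=
  fun t => if t = ⊤ then ⊤ else ENNReal.ofReal (Φ.toFun t.toReal)

def MemAPhi {n : ℕ} (Φ : NFunction) (ω : EuclideanSpace ℝ (Fin n) → ℝ) : Prop :=
  ∃ C : ℝ≥0∞, C ≠ ⊤ ∧ ∀ δ : ℝ, 0 < δ → ∀ (c : EuclideanSpace ℝ (Fin n)) (r : ℝ), 0 < r →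
    (⨍⁻ x in ball c r, ENNReal.ofReal (δ * ω x) ∂volume) *
      Φ.derE (⨍⁻ x in ball c r, ENNReal.ofReal (Φ.invDer (1 / (δ * ω x))) ∂volume) ≤ C

def MemBPhi {n : ℕ} (Φ : NFunction) (ω : EuclideanSpace ℝ (Fin n) → ℝ) : Prop :=
  ∀ (c : EuclideanSpace ℝ (Fin n)) (r : ℝ), 0 < r → ∃ μ > (0:ℝ),
    ∫⁻ x in ball c r, ENNReal.ofReal (Φ.conj (μ / ω x) * ω x) < ⊤

def MemMuckenhoupt {n : ℕ} (p : ℝ) (ω : EuclideanSpace ℝ (Fin n) → ℝ) : Prop :=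
  ∃ C : ℝ≥0∞, C ≠ ⊤ ∧ ∀ (c : EuclideanSpace ℝ (Fin n)) (r : ℝ), 0 < r →
    (⨍⁻ x in ball c r, ENNReal.ofReal (ω x) ∂volume) *
      (⨍⁻ x in ball c r, ENNReal.ofReal (ω x) ^ (-(1 / (p - 1))) ∂volume) ^ (p - 1) ≤ C

def maximalFn {n : ℕ} (g : EuclideanSpace ℝ (Fin n) → ℝ) (x : EuclideanSpace ℝ (Fin n)) : ℝ≥0∞ :=
  ⨆ (c : EuclideanSpace ℝ (Fin n)) (r : ℝ) (_ : 0 < r ∧ x ∈ ball c r),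
    ⨍⁻ y in ball c r, ENNReal.ofReal |g y| ∂volume

def NFunction.Structural (Φ : NFunction) (c₁ c₂ : ℝ) : Prop :=
  0 < c₁ ∧ c₁ ≤ c₂ ∧ ContDiffOn ℝ 1 Φ.toFun (Set.Ici 0) ∧ ContDiffOn ℝ 2 Φ.toFun (Set.Ioi 0) ∧
  ∀ t, 0 < t → c₁ * Φ.der t ≤ t * deriv Φ.der t ∧ t * deriv Φ.der t ≤ c₂ * Φ.der t

open Classical in
def AField {n : ℕ} (Φ : NFunction) (ζ : EuclideanSpace ℝ (Fin n)) : EuclideanSpace ℝ (Fin n) :=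
  if ζ = 0 then 0 else (Φ.der ‖ζ‖ / ‖ζ‖) • ζ

open Classical in
def VField {n : ℕ} (Φ : NFunction) (ζ : EuclideanSpace ℝ (Fin n)) : EuclideanSpace ℝ (Fin n) :=
  if ζ = 0 then 0 else (Real.sqrt (‖ζ‖ * Φ.der ‖ζ‖) / ‖ζ‖) • ζ

def NFunction.shiftedDer (Φ : NFunction) (a t : ℝ) : ℝ := Φ.der (a + t) * t / (a + t)

def NFunction.shifted (Φ : NFunction) (a t : ℝ) : ℝ := ∫ s in (0:ℝ)..t, Φ.shiftedDer a s

/-! ### Primitives of monotone functions -/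

section Primitive

variable {f : ℝ → ℝ}

lemma intervalIntegrable_of_monotoneOn_Ici (hf : MonotoneOn f (Set.Ici 0)) {a b : ℝ}
    (ha : 0 ≤ a) (hb : 0 ≤ b) : IntervalIntegrable f volume a b := by
  refine (hf.mono fun x hx => ?_).intervalIntegrable
  rw [Set.mem_uIcc] at hx
  rcases hx with h | h
  · exact ha.trans h.1
  · exact hb.trans h.1

lemma primitive_le_mul (hf : MonotoneOn f (Set.Ici 0)) {t : ℝ} (ht : 0 ≤ t) :
    ∫ s in (0:ℝ)..t, f s ≤ t * f t := by
  have := intervalIntegral.integral_mono_on (μ := volume) (g := fun _ => f t) ht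
    (intervalIntegrable_of_monotoneOn_Ici hf le_rfl ht) (by simp)
    (fun x hx => hf hx.1 ht hx.2)
  simpa using this

lemma mul_le_primitive_two_mul (hf : MonotoneOn f (Set.Ici 0)) (h0 : ∀ t, 0 ≤ f t) {t : ℝ}
    (ht : 0 ≤ t) : t * f t ≤ ∫ s in (0:ℝ)..(2 * t), f s := by
  have h2 : t ≤ 2 * t := by linarith
  rw [← intervalIntegral.integral_add_adjacent_intervals
    (intervalIntegrable_of_monotoneOn_Ici hf le_rfl ht)
    (intervalIntegrable_of_monotoneOn_Ici hf ht (ht.trans h2))]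
  have h := intervalIntegral.integral_mono_on (μ := volume) (f := fun _ => f t) h2 (by simp)
    (intervalIntegrable_of_monotoneOn_Ici hf ht (ht.trans h2))
    (fun x hx => hf ht (ht.trans hx.1) hx.1)
  have h' : 0 ≤ ∫ s in (0:ℝ)..t, f s := intervalIntegral.integral_nonneg ht fun x _ => h0 x
  simp only [intervalIntegral.integral_const, smul_eq_mul] at h
  nlinarith

lemma doubling_of_delta2_primitive (hf : MonotoneOn f (Set.Ici 0)) (h0 : ∀ t, 0 ≤ f t)
    (h : Delta2On fun t => ∫ s in (0:ℝ)..t, f s) :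
    ∃ D, 1 ≤ D ∧ ∀ t, 0 ≤ t → f (2 * t) ≤ D * f t := by
  obtain ⟨K, hK, h⟩ := h
  refine ⟨K ^ 2 + 1, by nlinarith, fun t ht => ?_⟩
  rcases ht.eq_or_lt with rfl | htpos
  · have := h0 0
    simp only [mul_zero]
    nlinarith
  have h1 := mul_le_primitive_two_mul hf h0 (t := 2 * t) (by linarith)
  have h2 := h (2 * t) (by linarith)
  have h3 := h t ht
  have h4 := primitive_le_mul hf ht
  have h5 : 2 * t * f (2 * t) ≤ K * (K * (t * f t)) :=
    (h1.trans h2).trans (by gcongr; exact h3.trans (by gcongr))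
  have h6 := h0 t
  have h7 : t * f (2 * t) ≤ t * ((K ^ 2 + 1) * f t) := by
    have := mul_nonneg ht (h0 (2 * t))
    have := mul_nonneg ht h6
    nlinarith
  exact le_of_mul_le_mul_left h7 htpos

lemma exists_doubling_const (hf : MonotoneOn f (Set.Ici 0)) {D : ℝ}
    (hD : 1 ≤ D) (h : ∀ t, 0 ≤ t → f (2 * t) ≤ D * f t) (L : ℝ) :
    ∃ A, 1 ≤ A ∧ ∀ s t, 0 ≤ s → 0 ≤ t → s ≤ L * t → f s ≤ A * f t := by
  obtain ⟨k, hk⟩ := pow_unbounded_of_one_lt L (one_lt_two (α := ℝ))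
  refine ⟨D ^ k, one_le_pow₀ hD, fun s t hs ht hst => ?_⟩
  have key : ∀ k : ℕ, f (2 ^ k * t) ≤ D ^ k * f t := by
    intro k
    induction k with
    | zero => simp
    | succ k ih =>
      calc f (2 ^ (k + 1) * t) = f (2 * (2 ^ k * t)) := by ring_nf
        _ ≤ D * f (2 ^ k * t) := h _ (by positivity)
        _ ≤ D * (D ^ k * f t) := by gcongr
        _ = _ := by ring
  refine (hf hs (Set.mem_Ici.2 (by positivity)) (hst.trans ?_)).trans (key k)
  gcongr

end Primitive

namespace NFunction

variable (Φ : NFunction)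

lemma der_le_der {s t : ℝ} (hs : 0 ≤ s) (h : s ≤ t) : Φ.der s ≤ Φ.der t :=
  Φ.der_mono hs (hs.trans h) h

lemma toFun_le_mul_der {t : ℝ} (ht : 0 ≤ t) : Φ.toFun t ≤ t * Φ.der t :=
  primitive_le_mul Φ.der_mono ht

lemma mul_der_le_toFun {t : ℝ} (ht : 0 ≤ t) : t * Φ.der t ≤ Φ.toFun (2 * t) :=
  mul_le_primitive_two_mul Φ.der_mono Φ.der_nonneg ht

lemma toFun_pos {t : ℝ} (ht : 0 < t) : 0 < Φ.toFun t := by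
  have := Φ.mul_der_le_toFun (t := t / 2) (by positivity)
  have h2 := Φ.der_pos (t / 2) (by positivity)
  rw [mul_div_cancel₀ t two_ne_zero] at this
  exact lt_of_lt_of_le (by positivity) this

lemma toFun_zero : Φ.toFun 0 = 0 := by simp [toFun]

lemma toFun_nonneg {t : ℝ} (ht : 0 ≤ t) : 0 ≤ Φ.toFun t :=
  intervalIntegral.integral_nonneg ht fun x _ => Φ.der_nonneg x

lemma toFun_mono {s t : ℝ} (hs : 0 ≤ s) (h : s ≤ t) : Φ.toFun s ≤ Φ.toFun t :=
  intervalIntegral.integral_mono_interval le_rfl hs h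
    (Eventually.of_forall fun x => Φ.der_nonneg x)
    (intervalIntegrable_of_monotoneOn_Ici Φ.der_mono le_rfl (hs.trans h))

lemma continuousOn_toFun : ContinuousOn Φ.toFun (Set.Ici 0) := by
  intro t ht
  have ht' : (0:ℝ) ≤ t := ht
  have h := intervalIntegral.continuousOn_primitive_interval (μ := volume) (f := Φ.der) (a := 0)
    (b := t + 1) (by
      rw [← intervalIntegrable_iff']
      exact intervalIntegrable_of_monotoneOn_Ici Φ.der_mono le_rfl (by linarith))
  rw [Set.uIcc_of_le (by linarith)] at h
  refine (h t ⟨ht', by linarith⟩).mono_of_mem_nhdsWithin ?_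
  filter_upwards [self_mem_nhdsWithin, nhdsWithin_le_nhds (Iic_mem_nhds (lt_add_one t))]
    with x hx hx' using ⟨hx, hx'⟩

lemma continuous_toFun_abs : Continuous fun t => Φ.toFun |t| :=
  Φ.continuousOn_toFun.comp_continuous continuous_abs fun t => abs_nonneg t

lemma measurable_der_max : Measurable fun t => Φ.der (max t 0) := by
  refine Monotone.measurable fun s t h => Φ.der_le_der (le_max_right _ _) ?_
  exact max_le_max_right 0 h

lemma exists_der_le_const_mul (hΦ : Delta2On Φ.toFun) (L : ℝ) :
    ∃ A, 1 ≤ A ∧ ∀ s t, 0 ≤ s → 0 ≤ t → s ≤ L * t → Φ.der s ≤ A * Φ.der t := by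
  obtain ⟨D, hD, h⟩ := doubling_of_delta2_primitive Φ.der_mono Φ.der_nonneg hΦ
  exact exists_doubling_const Φ.der_mono hD h L

/-! ### The right inverse of the derivative -/

lemma bddAbove_invDer_set (t : ℝ) : BddAbove {s : ℝ | 0 ≤ s ∧ Φ.der s ≤ t} := by
  obtain ⟨R, hR⟩ := (Φ.der_tendsto.eventually_gt_atTop t).exists_forall_of_atTop
  refine ⟨R, fun s hs => ?_⟩
  by_contra! hlt
  exact absurd hs.2 (not_le.2 (hR s hlt.le))

lemma le_invDer {s t : ℝ} (hs : 0 ≤ s) (h : Φ.der s ≤ t) : s ≤ Φ.invDer t :=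
  le_csSup (Φ.bddAbove_invDer_set t) ⟨hs, h⟩

lemma invDer_nonneg (t : ℝ) : 0 ≤ Φ.invDer t := Real.sSup_nonneg fun _ hs => hs.1

lemma invDer_le {s t : ℝ} (hs : 0 ≤ s) (h : t < Φ.der s) : Φ.invDer t ≤ s := by
  refine Real.sSup_le (fun u hu => ?_) hs
  by_contra! hlt
  exact absurd (Φ.der_le_der hs hlt.le) (not_le.2 (hu.2.trans_lt h))

lemma lt_der_of_invDer_lt {s t : ℝ} (h : Φ.invDer t < s) : t < Φ.der s := by
  by_contra! hle
  exact absurd (Φ.le_invDer ((Φ.invDer_nonneg t).trans h.le) hle) (not_le.2 h)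

lemma der_le_of_lt_invDer {s t : ℝ} (hs : 0 ≤ s) (h : s < Φ.invDer t) : Φ.der s ≤ t := by
  by_contra! hlt
  exact absurd (Φ.invDer_le hs hlt) (not_le.2 h)

lemma monotone_invDer : Monotone Φ.invDer := by
  intro s t h
  refine Real.sSup_le (fun u hu => Φ.le_invDer hu.1 (hu.2.trans h)) (Φ.invDer_nonneg t)

lemma le_der_invDer (t : ℝ) : t ≤ Φ.der (Φ.invDer t) := by
  have h := (Φ.der_rightCont _ (Φ.invDer_nonneg t)).mono
    (Set.Ioi_subset_Ici_self (a := Φ.invDer t))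
  refine ge_of_tendsto h ?_
  filter_upwards [self_mem_nhdsWithin] with s hs using (Φ.lt_der_of_invDer_lt hs).le

lemma exists_der_invDer_le (hΦ : Delta2On Φ.toFun) :
    ∃ A, 1 ≤ A ∧ ∀ t, 0 ≤ t → Φ.der (Φ.invDer t) ≤ A * t := by
  obtain ⟨A, hA, h⟩ := Φ.exists_der_le_const_mul hΦ 2
  refine ⟨A, hA, fun t ht => ?_⟩
  have h0 := Φ.invDer_nonneg t
  rcases h0.eq_or_lt with h1 | h1
  · rw [← h1, Φ.der_zero]; positivity
  · refine (h _ (Φ.invDer t / 2) h0 (by positivity) (by linarith)).trans ?_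
    gcongr
    exact Φ.der_le_of_lt_invDer (by positivity) (by linarith)

lemma exists_two_mul_der_le (hΦc : Delta2On Φ.conj) :
    ∃ L, 1 < L ∧ ∀ s, 0 ≤ s → 2 * Φ.der s ≤ Φ.der (L * s) := by
  obtain ⟨D, hD, h⟩ := doubling_of_delta2_primitive (Φ.monotone_invDer.monotoneOn _)
    Φ.invDer_nonneg hΦc
  refine ⟨D + 1, by linarith, fun s hs => ?_⟩
  rcases hs.eq_or_lt with rfl | hs
  · simp [Φ.der_zero]
  by_contra! hlt
  set t := Φ.der ((D + 1) * s) / 2 with ht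
  have ht0 : 0 ≤ t := div_nonneg (Φ.der_nonneg _) zero_le_two
  have h1 := Φ.invDer_le hs.le (t := t) (by linarith)
  have h2 := (h t ht0).trans (mul_le_mul_of_nonneg_left h1 (by linarith))
  have h3 := Φ.lt_der_of_invDer_lt (t := 2 * t) (s := (D + 1) * s) (by linarith)
  linarith

lemma exists_le_mul_of_der_le (hΦc : Delta2On Φ.conj) (A : ℝ) :
    ∃ L, 1 ≤ L ∧ ∀ a b, 0 ≤ a → 0 ≤ b → Φ.der a ≤ A * Φ.der b → a ≤ L * b := by
  obtain ⟨L, hL, h⟩ := Φ.exists_two_mul_der_le hΦc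
  obtain ⟨k, hk⟩ := pow_unbounded_of_one_lt A (one_lt_two (α := ℝ))
  refine ⟨L ^ k, one_le_pow₀ hL.le, fun a b ha hb hab => ?_⟩
  by_contra! hlt
  have key : ∀ k : ℕ, 2 ^ k * Φ.der b ≤ Φ.der (L ^ k * b) := by
    intro k
    induction k with
    | zero => simp
    | succ k ih =>
      calc 2 ^ (k + 1) * Φ.der b = 2 * (2 ^ k * Φ.der b) := by ring
        _ ≤ 2 * Φ.der (L ^ k * b) := by gcongr
        _ ≤ Φ.der (L * (L ^ k * b)) := h _ (by positivity)
        _ = _ := by ring_nf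
  have h1 := (key k).trans (Φ.der_le_der (by positivity) hlt.le)
  rcases hb.eq_or_lt with rfl | hb
  · rw [Φ.der_zero, mul_zero] at hab
    exact absurd hab (not_le.2 (Φ.der_pos a (by simpa using hlt)))
  · have := mul_lt_mul_of_pos_right hk (Φ.der_pos b hb)
    linarith

end NFunction

/-! ### The lower index -/

/-- Fekete's lemma for monotone submultiplicative functions on `(0, 1]`. -/
lemma exists_tendsto_log_div_log {h : ℝ → ℝ} {P : ℝ} (hle : ∀ l, 0 < l → l ≤ 1 → h l ≤ 1)
    (hmono : ∀ l m, 0 < l → l ≤ m → m ≤ 1 → h l ≤ h m)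
    (hmul : ∀ l m, 0 < l → l ≤ 1 → 0 < m → m ≤ 1 → h (l * m) ≤ h l * h m)
    (hP : ∀ l, 0 < l → l < 1 → l ^ P ≤ h l) :
    ∃ p, Tendsto (fun l => Real.log (h l) / Real.log l) (nhdsWithin 0 (Set.Ioi 0)) (nhds p) ∧
      ∀ l, 0 < l → l < 1 → Real.log (h l) / Real.log l ≤ p := by
  have hpos : ∀ l, 0 < l → l < 1 → 0 < h l := fun l h0 h1 =>
    (Real.rpow_pos_of_pos h0 P).trans_le (hP l h0 h1)
  set S : Set ℝ := {r | ∃ l, 0 < l ∧ l < 1 ∧ r = Real.log (h l) / Real.log l} with hS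
  have hbdd : BddAbove S := by
    refine ⟨P, ?_⟩
    rintro r ⟨l, h0, h1, rfl⟩
    rw [div_le_iff_of_neg (Real.log_neg h0 h1), ← Real.log_rpow h0]
    exact Real.log_le_log (Real.rpow_pos_of_pos h0 P) (hP l h0 h1)
  have hne : S.Nonempty := ⟨_, 1 / 2, by norm_num, by norm_num, rfl⟩
  have hub : ∀ l, 0 < l → l < 1 → Real.log (h l) / Real.log l ≤ sSup S := fun l h0 h1 =>
    le_csSup hbdd ⟨l, h0, h1, rfl⟩
  have hev : ∀ᶠ l : ℝ in nhdsWithin 0 (Set.Ioi 0), 0 < l ∧ l < 1 := by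
    filter_upwards [Ioo_mem_nhdsGT (zero_lt_one (α := ℝ))] with l hl using hl
  refine ⟨sSup S, tendsto_order.2 ⟨fun a ha => ?_, fun a ha => ?_⟩, hub⟩
  swap
  · filter_upwards [hev] with l hl using (hub l hl.1 hl.2).trans_lt ha
  obtain ⟨_, ⟨m, hm0, hm1, rfl⟩, hma⟩ := exists_lt_of_lt_csSup hne ha
  have hlm := Real.log_neg hm0 hm1
  have hr0 : 0 ≤ Real.log (h m) / Real.log m :=
    div_nonneg_of_nonpos (Real.log_nonpos (hpos m hm0 hm1).le (hle m hm0 hm1.le)) hlm.le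
  set r := Real.log (h m) / Real.log m with hr
  have hx : Tendsto (fun l => Real.log l / Real.log m) (nhdsWithin 0 (Set.Ioi 0)) atTop := by
    simp only [div_eq_mul_inv]
    exact Real.tendsto_log_nhdsGT_zero.atBot_mul_const_of_neg (inv_lt_zero.2 hlm)
  have hlim : Tendsto (fun l => r * (1 - (Real.log l / Real.log m)⁻¹))
      (nhdsWithin 0 (Set.Ioi 0)) (nhds (r * (1 - 0))) :=
    (tendsto_const_nhds.sub hx.inv_tendsto_atTop).const_mul r
  rw [sub_zero, mul_one] at hlim
  filter_upwards [hlim.eventually_const_lt hma, hev, hx.eventually_ge_atTop 1] with l hl hl01 hl1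
  refine hl.trans_le ?_
  set x := Real.log l / Real.log m with hxdef
  have hx0 : 0 < x := by linarith
  have hpow : ∀ k : ℕ, h (m ^ (k + 1)) ≤ h m ^ (k + 1) := by
    intro k
    induction k with
    | zero => simp
    | succ k ih =>
      rw [pow_succ, pow_succ (h m)]
      refine (hmul _ _ (by positivity) (pow_le_one₀ hm0.le hm1.le) hm0 hm1.le).trans ?_
      exact mul_le_mul_of_nonneg_right ih (hpos m hm0 hm1).le
  obtain ⟨k, hk⟩ : ∃ k : ℕ, ⌊x⌋₊ = k + 1 :=
    Nat.exists_eq_succ_of_ne_zero (Nat.floor_pos.2 hl1).ne'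
  have hkx : ((k + 1 : ℕ) : ℝ) ≤ x := hk ▸ Nat.floor_le hx0.le
  have hxk : x < ((k + 1 : ℕ) : ℝ) + 1 := hk ▸ Nat.lt_floor_add_one x
  have hlogl := Real.log_neg hl01.1 hl01.2
  have hlm' : l ≤ m ^ (k + 1) := by
    rw [← Real.log_le_log_iff hl01.1 (by positivity), Real.log_pow]
    have : Real.log l = x * Real.log m := (div_mul_cancel₀ _ hlm.ne).symm
    rw [this]
    exact mul_le_mul_of_nonpos_right hkx hlm.le
  have h1 : Real.log (h l) ≤ ((k + 1 : ℕ) : ℝ) * Real.log (h m) := by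
    rw [← Real.log_pow]
    exact Real.log_le_log (hpos l hl01.1 hl01.2)
      ((hmono _ _ hl01.1 hlm' (pow_le_one₀ hm0.le hm1.le)).trans (hpow k))
  rw [le_div_iff_of_neg hlogl]
  refine h1.trans ?_
  have e1 : Real.log (h m) = r * Real.log m := (div_mul_cancel₀ _ hlm.ne).symm
  have e2 : Real.log l = x * Real.log m := (div_mul_cancel₀ _ hlm.ne).symm
  rw [e1, e2]
  have e3 : r * (1 - x⁻¹) * (x * Real.log m) = (x - 1) * (r * Real.log m) := by field_simp
  rw [e3]
  exact mul_le_mul_of_nonpos_right (by linarith) (mul_nonpos_of_nonneg_of_nonpos hr0 hlm.le)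

namespace NFunction

variable (Φ : NFunction)

/-- The dilation function `sup_{t > 0} Φ(l t) / Φ(t)`. -/
def dilation (l : ℝ) : ℝ := sSup {r : ℝ | ∃ t > 0, r = Φ.toFun (l * t) / Φ.toFun t}

variable {Φ} in
lemma dilation_le {l c : ℝ} (h : ∀ t, 0 < t → Φ.toFun (l * t) ≤ c * Φ.toFun t) :
    Φ.dilation l ≤ c := by
  refine csSup_le ⟨_, 1, one_pos, rfl⟩ ?_
  rintro r ⟨t, ht, rfl⟩
  exact (div_le_iff₀ (Φ.toFun_pos ht)).2 (h t ht)

lemma toFun_mul_le_toFun {l t : ℝ} (h0 : 0 < l) (h1 : l ≤ 1) (ht : 0 < t) :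
    Φ.toFun (l * t) ≤ Φ.toFun t :=
  Φ.toFun_mono (by positivity) (mul_le_of_le_one_left ht.le h1)

lemma toFun_mul_le_dilation {l t : ℝ} (h0 : 0 < l) (h1 : l ≤ 1) (ht : 0 < t) :
    Φ.toFun (l * t) ≤ Φ.dilation l * Φ.toFun t := by
  rw [← div_le_iff₀ (Φ.toFun_pos ht)]
  refine le_csSup ⟨1, ?_⟩ ⟨t, ht, rfl⟩
  rintro r ⟨s, hs, rfl⟩
  exact (div_le_one (Φ.toFun_pos hs)).2 (Φ.toFun_mul_le_toFun h0 h1 hs)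

lemma dilation_le_one {l : ℝ} (h0 : 0 < l) (h1 : l ≤ 1) : Φ.dilation l ≤ 1 :=
  dilation_le fun t ht => by rw [one_mul]; exact Φ.toFun_mul_le_toFun h0 h1 ht

lemma dilation_pos {l : ℝ} (h0 : 0 < l) (h1 : l ≤ 1) : 0 < Φ.dilation l := by
  have := Φ.toFun_mul_le_dilation h0 h1 one_pos
  exact pos_of_mul_pos_left ((Φ.toFun_pos (by positivity)).trans_le this) (Φ.toFun_pos one_pos).le

lemma dilation_mono {l m : ℝ} (h0 : 0 < l) (hlm : l ≤ m) (h1 : m ≤ 1) :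
    Φ.dilation l ≤ Φ.dilation m := by
  refine dilation_le fun t ht => ?_
  refine le_trans ?_ (Φ.toFun_mul_le_dilation (h0.trans_le hlm) h1 ht)
  exact Φ.toFun_mono (by positivity) (by gcongr)

lemma dilation_mul_le {l m : ℝ} (hl0 : 0 < l) (hl1 : l ≤ 1) (hm0 : 0 < m) (hm1 : m ≤ 1) :
    Φ.dilation (l * m) ≤ Φ.dilation l * Φ.dilation m := by
  refine dilation_le fun t ht => ?_
  rw [mul_assoc, mul_assoc]
  refine (Φ.toFun_mul_le_dilation hl0 hl1 (by positivity)).trans ?_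
  have := Φ.dilation_pos hl0 hl1
  gcongr
  exact Φ.toFun_mul_le_dilation hm0 hm1 ht

lemma dilation_pow_le {l : ℝ} (hl0 : 0 < l) (hl1 : l ≤ 1) (k : ℕ) :
    Φ.dilation (l ^ (k + 1)) ≤ Φ.dilation l ^ (k + 1) := by
  induction k with
  | zero => simp
  | succ k ih =>
    rw [pow_succ, pow_succ (Φ.dilation l)]
    refine (Φ.dilation_mul_le (by positivity) (pow_le_one₀ hl0.le hl1) hl0 hl1).trans ?_
    exact mul_le_mul_of_nonneg_right ih (Φ.dilation_pos hl0 hl1).le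

lemma exists_rpow_le_dilation (hΦ : Delta2On Φ.toFun) :
    ∃ P : ℝ, ∀ l, 0 < l → l < 1 → l ^ P ≤ Φ.dilation l := by
  obtain ⟨K, hK, h⟩ := hΦ
  have hK1 : 1 ≤ K := by
    have h1 := h 1 zero_le_one
    have h2 := Φ.toFun_mono zero_le_one (t := 2 * 1) (by norm_num)
    have h3 := Φ.toFun_pos one_pos
    by_contra! hlt
    nlinarith
  have hiter : ∀ k : ℕ, Φ.toFun 1 ≤ K ^ k * Φ.toFun ((1 / 2) ^ k) := by
    intro k
    induction k with
    | zero => simp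
    | succ k ih =>
      refine ih.trans ?_
      have := h ((1 / 2) ^ (k + 1)) (by positivity)
      rw [show (2:ℝ) * (1 / 2) ^ (k + 1) = (1 / 2) ^ k by ring] at this
      calc K ^ k * Φ.toFun ((1 / 2) ^ k) ≤ K ^ k * (K * Φ.toFun ((1 / 2) ^ (k + 1))) := by gcongr
        _ = _ := by ring
  have hl2 : 0 < Real.log 2 := Real.log_pos one_lt_two
  set P : ℝ := 2 * Real.log K / Real.log 2 with hP
  have hP0 : 0 ≤ P := div_nonneg (mul_nonneg zero_le_two (Real.log_nonneg hK1)) hl2.le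
  have hsmall : ∀ l, 0 < l → l ≤ 1 / 2 → l ^ P ≤ Φ.dilation l := by
    intro l h0 h1
    obtain ⟨k, hk1, hk2⟩ := exists_nat_pow_near_of_lt_one (x := l) (y := (1/2 : ℝ)) h0
      (by linarith) (by norm_num) (by norm_num)
    have hl1 : l ≤ 1 := by linarith
    have hd := Φ.toFun_mul_le_dilation h0 hl1 one_pos
    rw [mul_one] at hd
    have h3 : Φ.toFun ((1 / 2) ^ (k + 1)) ≤ Φ.toFun l := Φ.toFun_mono (by positivity) hk1.le
    have h4 := hiter (k + 1)
    have h5 : 1 ≤ K ^ (k + 1) * Φ.dilation l := by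
      have h6 : Φ.toFun 1 * 1 ≤ Φ.toFun 1 * (K ^ (k + 1) * Φ.dilation l) := by
        calc Φ.toFun 1 * 1 ≤ K ^ (k + 1) * Φ.toFun ((1 / 2) ^ (k + 1)) := by simpa using h4
          _ ≤ K ^ (k + 1) * (Φ.dilation l * Φ.toFun 1) := by gcongr; exact h3.trans hd
          _ = _ := by ring
      exact le_of_mul_le_mul_left h6 (Φ.toFun_pos one_pos)
    have hkpos : 1 ≤ k := by
      by_contra! h0k
      obtain rfl : k = 0 := by omega
      norm_num at hk1
      linarith
    have h7 : l ^ P * K ^ (k + 1) ≤ 1 := by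
      rw [← Real.log_nonpos_iff (by positivity), Real.log_mul (by positivity) (by positivity),
        Real.log_rpow h0, Real.log_pow]
      have hll : Real.log l ≤ -(k * Real.log 2) := by
        have := Real.log_le_log h0 hk2
        rwa [Real.log_pow, one_div, Real.log_inv, mul_neg] at this
      have : P * Real.log l ≤ P * -(k * Real.log 2) := by gcongr
      have e : P * -(k * Real.log 2) = -(2 * k * Real.log K) := by rw [hP]; field_simp
      have hk' : (1:ℝ) ≤ k := by exact_mod_cast hkpos
      have := Real.log_nonneg hK1
      push_cast
      nlinarith
    have hKp : 0 < K ^ (k + 1) := by positivity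
    have := h7.trans h5
    rw [mul_comm] at this
    exact le_of_mul_le_mul_left this hKp
  refine ⟨P, fun l h0 h1 => ?_⟩
  obtain ⟨k, hk⟩ := exists_pow_lt_of_lt_one (show (0:ℝ) < 1 / 2 by norm_num) h1
  have hk' : l ^ (k + 1) ≤ 1 / 2 := by
    rw [pow_succ]
    have : l ^ k * l ≤ l ^ k := mul_le_of_le_one_right (by positivity) h1.le
    linarith
  have h2 := (hsmall _ (by positivity) hk').trans (Φ.dilation_pow_le h0 h1.le k)
  rw [← Real.rpow_natCast, ← Real.rpow_mul h0.le, mul_comm, Real.rpow_mul h0.le,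
    Real.rpow_natCast] at h2
  exact (pow_le_pow_iff_left₀ (by positivity) (Φ.dilation_pos h0 h1.le).le (by simp)).1 h2

lemma tendsto_lowerIndex (hΦ : Delta2On Φ.toFun) :
    Tendsto (fun l => Real.log (Φ.dilation l) / Real.log l) (nhdsWithin 0 (Set.Ioi 0))
      (nhds Φ.lowerIndex) ∧
      ∀ l, 0 < l → l < 1 → Real.log (Φ.dilation l) / Real.log l ≤ Φ.lowerIndex := by
  obtain ⟨P, hP⟩ := Φ.exists_rpow_le_dilation hΦ
  obtain ⟨p, hp, hp'⟩ := exists_tendsto_log_div_log (fun l => Φ.dilation_le_one)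
    (fun l m => Φ.dilation_mono) (fun l m => Φ.dilation_mul_le) hP
  have : Φ.lowerIndex = p := hp.limUnder_eq
  rw [this]
  exact ⟨hp, hp'⟩

lemma rpow_lowerIndex_le_dilation (hΦ : Delta2On Φ.toFun) {l : ℝ} (h0 : 0 < l) (h1 : l < 1) :
    l ^ Φ.lowerIndex ≤ Φ.dilation l := by
  have h := (Φ.tendsto_lowerIndex hΦ).2 l h0 h1
  rw [div_le_iff_of_neg (Real.log_neg h0 h1), ← Real.log_rpow h0] at h
  exact (Real.log_le_log_iff (by positivity) (Φ.dilation_pos h0 h1.le)).1 h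

/-- The lower index is almost attained at every scale. -/
lemma exists_rpow_lowerIndex_le (hΦ : Delta2On Φ.toFun) {l : ℝ} (h0 : 0 < l) (h1 : l ≤ 1) :
    ∃ t, 0 < t ∧ l ^ Φ.lowerIndex / 2 * Φ.toFun t ≤ Φ.toFun (l * t) := by
  rcases h1.eq_or_lt with rfl | h1
  · refine ⟨1, one_pos, ?_⟩
    have := Φ.toFun_pos one_pos
    simp only [Real.one_rpow, mul_one]
    linarith
  have h2 : l ^ Φ.lowerIndex / 2 < Φ.dilation l :=
    (half_lt_self (Real.rpow_pos_of_pos h0 _)).trans_le (Φ.rpow_lowerIndex_le_dilation hΦ h0 h1)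
  by_contra! hlt
  exact absurd (dilation_le fun t ht => (hlt t ht).le) (not_le.2 h2)

lemma one_lt_lowerIndex (hΦ : Delta2On Φ.toFun) (hΦc : Delta2On Φ.conj) : 1 < Φ.lowerIndex := by
  obtain ⟨L, hL, h⟩ := Φ.exists_two_mul_der_le hΦc
  have hL0 : 0 < L := by linarith
  have hInteg : ∀ t, 0 < t → Φ.toFun (L⁻¹ * t) ≤ (2 * L)⁻¹ * Φ.toFun t := by
    intro t ht
    have hs : 0 ≤ L⁻¹ * t := by positivity
    have h1 : ∫ s in (0:ℝ)..(L⁻¹ * t), 2 * Φ.der s ≤ ∫ s in (0:ℝ)..(L⁻¹ * t), Φ.der (L * s) := by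
      refine intervalIntegral.integral_mono_on hs
        ((intervalIntegrable_of_monotoneOn_Ici Φ.der_mono le_rfl hs).const_mul 2)
        (intervalIntegrable_of_monotoneOn_Ici (fun a ha b hb hab => ?_) le_rfl hs)
        fun x hx => h x hx.1
      exact Φ.der_le_der (mul_nonneg hL0.le ha) (by gcongr)
    rw [intervalIntegral.integral_const_mul,
      intervalIntegral.integral_comp_mul_left _ hL0.ne'] at h1
    rw [mul_zero, mul_inv_cancel_left₀ hL0.ne', smul_eq_mul] at h1
    change 2 * Φ.toFun (L⁻¹ * t) ≤ L⁻¹ * Φ.toFun t at h1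
    rw [mul_inv]
    linarith
  have hd := dilation_le hInteg
  have hLi0 : 0 < L⁻¹ := by positivity
  have hLi1 : L⁻¹ < 1 := inv_lt_one_of_one_lt₀ hL
  refine lt_of_lt_of_le ?_ ((Φ.tendsto_lowerIndex hΦ).2 L⁻¹ hLi0 hLi1)
  rw [lt_div_iff_of_neg (Real.log_neg hLi0 hLi1), one_mul]
  refine Real.log_lt_log (Φ.dilation_pos hLi0 hLi1.le) (hd.trans_lt ?_)
  rw [mul_inv]
  linarith

lemma exists_toFun_mul_le_rpow (hΦ : Delta2On Φ.toFun) {q : ℝ} (hq0 : 0 ≤ q)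
    (hq : q < Φ.lowerIndex) :
    ∃ C, 0 < C ∧ ∀ l t, 0 < l → l ≤ 1 → 0 < t →
      Φ.toFun (l * t) ≤ C * l ^ q * Φ.toFun t := by
  have h := (Φ.tendsto_lowerIndex hΦ).1.eventually_const_lt hq
  obtain ⟨d, hd0, hd⟩ := mem_nhdsGT_iff_exists_Ioc_subset.1 h
  have hd0 : 0 < d := hd0
  set e := min d (1 / 2) with he
  have he0 : 0 < e := lt_min hd0 (by norm_num)
  refine ⟨max 1 (e ^ (-q)), by positivity, fun l t hl0 hl1 ht => ?_⟩
  have hTt := Φ.toFun_pos ht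
  rcases le_total l e with hle | hle
  · have hl1' : l < 1 := by linarith [min_le_right d (1 / 2)]
    have h2 : q < Real.log (Φ.dilation l) / Real.log l := hd ⟨hl0, hle.trans (min_le_left _ _)⟩
    rw [lt_div_iff_of_neg (Real.log_neg hl0 hl1'), ← Real.log_rpow hl0] at h2
    have h3 := (Real.log_lt_log_iff (Φ.dilation_pos hl0 hl1) (by positivity)).1 h2
    refine (Φ.toFun_mul_le_dilation hl0 hl1 ht).trans ?_
    gcongr
    refine h3.le.trans (le_mul_of_one_le_left (by positivity) (le_max_left _ _))
  · refine (Φ.toFun_mul_le_toFun hl0 hl1 ht).trans ?_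
    refine le_mul_of_one_le_left hTt.le ?_
    calc (1:ℝ) = e ^ (-q) * e ^ q := by rw [← Real.rpow_add he0]; simp
      _ ≤ max 1 (e ^ (-q)) * l ^ q := by
        gcongr
        exact le_max_right _ _

end NFunction

/-! ### Reverse Hölder inequality -/

section ReverseHolder

variable {n : ℕ}

local notation "𝔼" => EuclideanSpace ℝ (Fin n)

lemma volume_ball_mul (x y : 𝔼) {a r : ℝ} (ha : 0 < a) :
    volume (ball x (a * r)) = ENNReal.ofReal (a ^ n) * volume (ball y r) := by
  rw [Measure.addHaar_ball_mul_of_pos volume x ha, Measure.addHaar_ball_center volume y]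
  simp

lemma exists_ball_half_subset {x₀ x : 𝔼} {R r : ℝ} (hx : x ∈ ball x₀ R) (hr : 0 < r)
    (hrR : r ≤ 2 * R) : ∃ y, ball y (r / 2) ⊆ ball x r ∩ ball x₀ R := by
  have hR : 0 < R := by linarith
  rw [mem_ball_iff_norm] at hx
  set t := r / (2 * R) with ht
  have ht0 : 0 ≤ t := by positivity
  have ht1 : t ≤ 1 := (div_le_one (by positivity)).2 hrR
  have htR : t * R = r / 2 := by rw [ht]; field_simp
  refine ⟨x + t • (x₀ - x), Set.subset_inter (ball_subset_ball' ?_) (ball_subset_ball' ?_)⟩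
  · rw [dist_eq_norm, add_sub_cancel_left, norm_smul, Real.norm_eq_abs, abs_of_nonneg ht0,
      norm_sub_rev]
    nlinarith
  · rw [dist_eq_norm, show x + t • (x₀ - x) - x₀ = (1 - t) • (x - x₀) by module, norm_smul,
      Real.norm_eq_abs, abs_of_nonneg (by linarith)]
    nlinarith

/-- The weighted measure of a ball is controlled by that of each of its large subsets. -/
def LargeSubsetBound (θ κ : ℝ) (ν : Measure 𝔼) : Prop :=
  ∀ (c : 𝔼) (r : ℝ), 0 < r → ∀ F, MeasurableSet F → F ⊆ ball c r →
    ENNReal.ofReal κ * volume (ball c r) ≤ volume F → ENNReal.ofReal θ * ν (ball c r) ≤ ν F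

variable {σ : EuclideanSpace ℝ (Fin n) → ℝ}

lemma ae_exists_pow_lt_of_lt (hσ : Measurable σ) {x₀ : 𝔼} {R l : ℝ} (hR : 0 < R)
    (hfin : (volume.withDensity fun x => ENNReal.ofReal (σ x)) (ball x₀ R) < ⊤) :
    ∀ᵐ x ∂(volume : Measure 𝔼), x ∈ ball x₀ R → 0 < l → l < σ x → ∃ k : ℕ,
      ENNReal.ofReal l * volume (ball x (2 * R * (1 / 5) ^ k)) <
        (volume.withDensity fun x => ENNReal.ofReal (σ x))
          (ball x₀ R ∩ ball x (2 * R * (1 / 5) ^ k)) := by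
  set f : 𝔼 → ℝ≥0∞ := (ball x₀ R).indicator fun x => ENNReal.ofReal (σ x) with hf
  have hfm : Measurable f := hσ.ennreal_ofReal.indicator measurableSet_ball
  have hfi : ∫⁻ y, f y ≠ ⊤ := by
    rw [lintegral_indicator measurableSet_ball, ← withDensity_apply _ measurableSet_ball]
    exact hfin.ne
  filter_upwards [(IsUnifLocDoublingMeasure.vitaliFamily
    (volume : Measure 𝔼) 1).ae_tendsto_lintegral_div hfm.aemeasurable hfi] with x hx hxB hl hlx
  have hrad : Tendsto (fun k : ℕ => 2 * R * (1 / 5 : ℝ) ^ k) atTop (nhdsWithin 0 (Set.Ioi 0)) := by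
    refine tendsto_nhdsWithin_iff.2 ⟨?_, Eventually.of_forall fun k => Set.mem_Ioi.2 (by positivity)⟩
    simpa using (tendsto_pow_atTop_nhds_zero_of_lt_one (show (0:ℝ) ≤ 1 / 5 by norm_num)
      (by norm_num)).const_mul (2 * R)
  have ht := hx.comp (IsUnifLocDoublingMeasure.tendsto_closedBall_filterAt (volume : Measure 𝔼)
    (K := 1) (x := x) (fun _ => x) _ hrad (Eventually.of_forall fun k =>
      mem_closedBall_self (by positivity)))
  have hfx : f x = ENNReal.ofReal (σ x) := Set.indicator_of_mem hxB _
  rw [hfx] at ht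
  obtain ⟨k, hk⟩ := (ht.eventually_const_lt
    ((ENNReal.ofReal_lt_ofReal_iff (hl.trans hlx)).2 hlx)).exists
  refine ⟨k, ?_⟩
  set r := 2 * R * (1 / 5 : ℝ) ^ k with hr
  have hr0 : 0 < r := by positivity
  have hae : (ball x r : Set 𝔼) =ᵐ[volume] closedBall x r := by
    rw [← ball_union_sphere]
    refine (union_ae_eq_left_of_ae_eq_empty ?_).symm
    exact ae_eq_empty.2 (Measure.addHaar_sphere_of_ne_zero volume x hr0.ne')
  have hkBall : ENNReal.ofReal l < (∫⁻ y in closedBall x r, f y) / volume (closedBall x r) := hk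
  rw [← setLIntegral_congr hae, ← measure_congr hae,
    ENNReal.lt_div_iff_mul_lt (Or.inl (measure_ball_pos volume x hr0).ne')
      (Or.inl measure_ball_lt_top.ne), hf, setLIntegral_indicator measurableSet_ball,
    ← withDensity_apply _ (measurableSet_ball.inter measurableSet_ball)] at hkBall
  exact hkBall

/-- Superlevel sets of a weight with the large subset bound decay in the sense of Gehring. -/
lemma measure_superlevel_le {θ : ℝ} (hθ : 0 < θ) (hσ : Measurable σ)
    (hfin : ∀ c r, (volume.withDensity fun x => ENNReal.ofReal (σ x)) (ball c r) < ⊤)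
    (H : LargeSubsetBound θ ((1 / 2) ^ (n + 1)) (volume.withDensity fun x => ENNReal.ofReal (σ x)))
    {x₀ : 𝔼} {R l : ℝ} (hR : 0 < R) (hl : 0 < l)
    (hlB : (volume.withDensity fun x => ENNReal.ofReal (σ x)) (ball x₀ R) ≤
      ENNReal.ofReal l * volume (ball x₀ R)) :
    (volume.withDensity fun x => ENNReal.ofReal (σ x)) (ball x₀ R ∩ {x | l < σ x}) ≤
      ENNReal.ofReal (10 ^ (n + 1) * l) * volume (ball x₀ R ∩ {x | θ / 2 * l < σ x}) := by
  set ν := volume.withDensity fun x => ENNReal.ofReal (σ x) with hν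
  set ρ : ℕ → ℝ := fun k => 2 * R * (1 / 5) ^ k with hρ
  have hρ0 : ∀ k, 0 < ρ k := fun k => by positivity
  have hρR : ∀ k, ρ k ≤ 2 * R := fun k =>
    mul_le_of_le_one_right (by positivity) (pow_le_one₀ (by norm_num) (by norm_num))
  set T : Set 𝔼 := {x | x ∈ ball x₀ R ∧ ∃ r, 0 < r ∧ r ≤ 2 * R ∧
    ENNReal.ofReal l * volume (ball x r) < ν (ball x₀ R ∩ ball x r) ∧
    ν (ball x₀ R ∩ ball x (5 * r)) ≤ ENNReal.ofReal l * volume (ball x (5 * r))} with hT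
  have hsub : ∀ᵐ x ∂(volume : Measure 𝔼), x ∈ ball x₀ R ∩ {x | l < σ x} → x ∈ T := by
    filter_upwards [ae_exists_pow_lt_of_lt (l := l) hσ hR (hfin x₀ R)] with x hx hxm
    have hex := hx hxm.1 hl hxm.2
    classical
    set k := Nat.find hex with hk
    have hk1 := Nat.find_spec hex
    have hk0 : k ≠ 0 := by
      intro h0
      rw [← hk, h0] at hk1
      refine absurd hk1 (not_lt.2 ?_)
      refine (measure_mono Set.inter_subset_left).trans (hlB.trans ?_)
      gcongr
      rw [pow_zero, mul_one]
      refine ball_subset_ball' ?_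
      have := mem_ball.1 hxm.1
      rw [dist_comm]
      linarith
    obtain ⟨j, hj⟩ := Nat.exists_eq_succ_of_ne_zero hk0
    have hj' := Nat.find_min hex (m := j) (by omega)
    refine ⟨hxm.1, ρ k, hρ0 k, hρR k, hk1, ?_⟩
    have : 5 * ρ k = 2 * R * (1 / 5) ^ j := by
      simp only [hρ, hj, Nat.succ_eq_add_one, pow_succ]; ring
    rw [this]
    exact not_lt.1 hj'
  choose! r hr using fun x (hx : x ∈ T) => hx.2
  obtain ⟨u, huT, hdisj, hcov⟩ := Vitali.exists_disjoint_subfamily_covering_enlargement_ball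
    T id r (2 * R) (fun x hx => (hr x hx).2.1) 5 (by norm_num)
  simp only [id] at hdisj hcov
  have hucount : u.Countable := hdisj.countable_of_isOpen (fun _ _ => isOpen_ball)
    fun x hx => ⟨x, mem_ball_self (hr x (huT hx)).1⟩
  have hG : MeasurableSet (ball x₀ R ∩ {x | θ / 2 * l < σ x}) :=
    measurableSet_ball.inter (measurableSet_lt measurable_const hσ)
  have hsingle : ∀ x ∈ T, ν (ball x₀ R ∩ ball x (5 * r x)) ≤
      ENNReal.ofReal (10 ^ (n + 1) * l) *
        volume (ball x₀ R ∩ {x | θ / 2 * l < σ x} ∩ ball x (r x)) := by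
    intro x hx
    obtain ⟨hr0, hr2, hr3, hr4⟩ := hr x hx
    set B := ball x (r x) with hB
    set κ : ℝ := (1 / 2) ^ (n + 1) with hκ
    set F := ball x₀ R ∩ B ∩ {x | σ x ≤ θ / 2 * l} with hF
    have hFm : MeasurableSet F :=
      (measurableSet_ball.inter measurableSet_ball).inter (measurableSet_le hσ measurable_const)
    have hFB : F ⊆ B := fun y hy => hy.1.2
    have hνF : ν F ≤ ENNReal.ofReal (θ / 2 * l) * volume B := by
      rw [hν, withDensity_apply _ hFm]
      refine (setLIntegral_mono' (g := fun _ => ENNReal.ofReal (θ / 2 * l)) hFm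
        fun y hy => ENNReal.ofReal_le_ofReal hy.2).trans ?_
      rw [setLIntegral_const]
      gcongr
    have hνB : ν B < ⊤ := hfin _ _
    have hlt : volume F < ENNReal.ofReal κ * volume B := by
      by_contra! hle
      have h1 := (H x (r x) hr0 F hFm hFB hle).trans hνF
      have h2 : ENNReal.ofReal l * volume B < ν B :=
        hr3.trans_le (measure_mono Set.inter_subset_right)
      have h3 : ENNReal.ofReal (θ / 2 * l) * volume B ≤ ENNReal.ofReal (θ / 2) * ν B := by
        rw [ENNReal.ofReal_mul (by positivity), mul_assoc]
        gcongr
      have h4 : ν B ≠ 0 := (pos_of_gt h2).ne'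
      have h5 := (ENNReal.mul_le_mul_iff_left h4 hνB.ne).1 (h1.trans h3)
      rw [ENNReal.ofReal_le_ofReal_iff (by positivity)] at h5
      linarith
    obtain ⟨y, hy⟩ := exists_ball_half_subset hx.1 hr0 hr2
    have hD : ENNReal.ofReal κ * volume B + ENNReal.ofReal κ * volume B ≤
        volume (ball x₀ R ∩ B) := by
      rw [← add_mul, ← ENNReal.ofReal_add (by positivity) (by positivity)]
      have : κ + κ = (1 / 2) ^ n := by rw [hκ, pow_succ]; ring
      rw [this, hB, ← volume_ball_mul y x (by norm_num : (0:ℝ) < 1 / 2), Set.inter_comm]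
      exact measure_mono (by rwa [one_div_mul_eq_div])
    have hcover : volume (ball x₀ R ∩ B) ≤
        volume F + volume (ball x₀ R ∩ {x | θ / 2 * l < σ x} ∩ B) := by
      refine (measure_mono fun z hz => ?_).trans (measure_union_le _ _)
      rcases le_or_gt (σ z) (θ / 2 * l) with h | h
      · exact Or.inl ⟨hz, h⟩
      · exact Or.inr ⟨⟨hz.1, h⟩, hz.2⟩
    have hGB : ENNReal.ofReal κ * volume B ≤
        volume (ball x₀ R ∩ {x | θ / 2 * l < σ x} ∩ B) := by
      have h1 := hD.trans (hcover.trans (add_le_add_left hlt.le _))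
      exact (ENNReal.add_le_add_iff_left
        (ENNReal.mul_ne_top ENNReal.ofReal_ne_top measure_ball_lt_top.ne)).1 h1
    refine hr4.trans ?_
    rw [volume_ball_mul x x (by norm_num : (0:ℝ) < 5)]
    have hA : ENNReal.ofReal l * (ENNReal.ofReal (5 ^ n) * volume B) ≤
        ENNReal.ofReal (10 ^ (n + 1) * l) * (ENNReal.ofReal κ * volume B) := by
      rw [← mul_assoc, ← mul_assoc, ← ENNReal.ofReal_mul hl.le,
        ← ENNReal.ofReal_mul (by positivity)]
      refine mul_le_mul' (ENNReal.ofReal_le_ofReal ?_) le_rfl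
      have : (10:ℝ) ^ (n + 1) * l * κ = 5 ^ (n + 1) * l := by
        rw [hκ, mul_right_comm, ← mul_pow]; norm_num
      rw [this, pow_succ]
      have : 0 < l * 5 ^ n := by positivity
      nlinarith
    exact hA.trans (by gcongr)
  calc ν (ball x₀ R ∩ {x | l < σ x}) ≤ ν (⋃ x ∈ u, ball x₀ R ∩ ball x (5 * r x)) := by
        refine measure_mono_ae ?_
        filter_upwards [(withDensity_absolutelyContinuous volume _).ae_le hsub] with x hx hxm
        obtain ⟨b, hbu, hb⟩ := hcov x (hx hxm)
        exact Set.mem_biUnion hbu ⟨hxm.1, hb (mem_ball_self (hr x (hx hxm)).1)⟩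
    _ ≤ ∑' x : u, ν (ball x₀ R ∩ ball (x : 𝔼) (5 * r x)) := measure_biUnion_le _ hucount _
    _ ≤ ∑' x : u, ENNReal.ofReal (10 ^ (n + 1) * l) *
          volume (ball x₀ R ∩ {x | θ / 2 * l < σ x} ∩ ball (x : 𝔼) (r x)) :=
        ENNReal.tsum_le_tsum fun x => hsingle x (huT x.2)
    _ = ENNReal.ofReal (10 ^ (n + 1) * l) *
          volume (⋃ x ∈ u, ball x₀ R ∩ {x | θ / 2 * l < σ x} ∩ ball x (r x)) := by
        rw [ENNReal.tsum_mul_left, measure_biUnion hucount]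
        · exact hdisj.mono fun x => Set.inter_subset_right
        · exact fun x _ => hG.inter measurableSet_ball
    _ ≤ _ := by
        gcongr
        exact Set.iUnion₂_subset fun x _ => Set.inter_subset_left

lemma lintegral_rpow_Ioc_zero {m ε : ℝ} (hm : 0 ≤ m) (hε : 0 < ε) :
    ∫⁻ t in Set.Ioc 0 m, ENNReal.ofReal (t ^ (ε - 1)) = ENNReal.ofReal (m ^ ε / ε) := by
  have hInteg : IntervalIntegrable (fun t : ℝ => t ^ (ε - 1)) volume 0 m :=
    intervalIntegral.intervalIntegrable_rpow' (by linarith)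
  rw [← ofReal_integral_eq_lintegral_ofReal
    ((intervalIntegrable_iff_integrableOn_Ioc_of_le hm).1 hInteg)
    ((ae_restrict_iff' measurableSet_Ioc).2 (Eventually.of_forall fun t ht =>
      Real.rpow_nonneg ht.1.le _)), ← intervalIntegral.integral_of_le hm,
    integral_rpow (Or.inl (by linarith))]
  simp [Real.zero_rpow (ne_of_gt hε)]

/-- Absorption step: integrating the superlevel bound against a small power. -/
lemma lintegral_rpow_le_of_superlevel {X : Type*} [MeasurableSpace X] {μ : Measure X}
    {σ : X → ℝ} (hσ : Measurable σ) (hσ0 : ∀ x, 0 ≤ σ x)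
    (hfin : (μ.withDensity fun x => ENNReal.ofReal (σ x)) Set.univ < ⊤)
    {A η ε m : ℝ} (hA : 0 < A) (hη : 0 < η) (hη1 : η ≤ 1) (hε : 0 < ε) (hε1 : ε ≤ 1)
    (hεA : ε * A * (η ^ 2)⁻¹ ≤ 1 / 2) (hm : 0 ≤ m)
    (H : ∀ l, m < l → (μ.withDensity fun x => ENNReal.ofReal (σ x)) {x | l < σ x} ≤
      ENNReal.ofReal (A * l) * μ {x | η * l < σ x}) :
    ∫⁻ x, ENNReal.ofReal (σ x ^ (1 + ε)) ∂μ ≤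
      2 * (ENNReal.ofReal (m ^ ε) * (μ.withDensity fun x => ENNReal.ofReal (σ x)) Set.univ) := by
  set ν := μ.withDensity fun x => ENNReal.ofReal (σ x) with hν
  set s : ℕ → X → ℝ := fun N x => min (σ x) N with hs
  have hsm : ∀ N, Measurable (s N) := fun N => hσ.min measurable_const
  have hs0 : ∀ N x, 0 ≤ s N x := fun N x => le_min (hσ0 x) N.cast_nonneg
  have htrunc : ∀ N, ∫⁻ x, ENNReal.ofReal (s N x ^ ε) ∂ν ≤
      2 * (ENNReal.ofReal (m ^ ε) * ν Set.univ) := by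
    intro N
    set I := ∫⁻ x, ENNReal.ofReal (s N x ^ ε) ∂ν with hI
    have hIfin : I ≠ ⊤ := by
      refine ne_top_of_le_ne_top (b := ∫⁻ x, ENNReal.ofReal ((N:ℝ) ^ ε) ∂ν) ?_ ?_
      · rw [lintegral_const]
        exact ENNReal.mul_ne_top ENNReal.ofReal_ne_top hfin.ne
      · refine lintegral_mono fun x => ENNReal.ofReal_le_ofReal ?_
        exact Real.rpow_le_rpow (hs0 N x) (min_le_right _ _) hε.le
    have hI2 : I = ENNReal.ofReal ε *
        ∫⁻ t in Set.Ioi (0:ℝ), ν {x | t < s N x} * ENNReal.ofReal (t ^ (ε - 1)) :=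
      lintegral_rpow_eq_lintegral_meas_lt_mul ν (Eventually.of_forall (hs0 N))
        (hsm N).aemeasurable hε
    have hsplit : Set.Ioi (0:ℝ) = Set.Ioc 0 m ∪ Set.Ioi m := (Set.Ioc_union_Ioi_eq_Ioi hm).symm
    have hlow : ∫⁻ t in Set.Ioc (0:ℝ) m, ν {x | t < s N x} * ENNReal.ofReal (t ^ (ε - 1)) ≤
        ν Set.univ * ENNReal.ofReal (m ^ ε / ε) := by
      rw [← lintegral_rpow_Ioc_zero hm hε, ← lintegral_const_mul' _ _ hfin.ne]
      exact lintegral_mono fun t => mul_le_mul' (measure_mono (Set.subset_univ _)) le_rfl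
    have hhigh : ∫⁻ t in Set.Ioi m, ν {x | t < s N x} * ENNReal.ofReal (t ^ (ε - 1)) ≤
        ENNReal.ofReal (A * (η ^ 2)⁻¹) * I := by
      have hpt : ∀ t ∈ Set.Ioi m, ν {x | t < s N x} * ENNReal.ofReal (t ^ (ε - 1)) ≤
          ENNReal.ofReal A * (μ {x | t < s N x / η} * ENNReal.ofReal (t ^ (1 + ε - 1))) := by
        intro t ht
        have ht0 : 0 < t := hm.trans_lt ht
        have h1 : ν {x | t < s N x} ≤ ENNReal.ofReal (A * t) * μ {x | t < s N x / η} := by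
          by_cases htN : t < N
          · refine (measure_mono fun x hx => ?_).trans ((H t ht).trans ?_)
            · have hx' : t < min (σ x) N := hx
              exact (lt_min_iff.1 hx').1
            · refine mul_le_mul' le_rfl (measure_mono fun x hx => ?_)
              change t < s N x / η
              rw [lt_div_iff₀ hη, mul_comm]
              exact lt_min hx ((mul_le_of_le_one_left ht0.le hη1).trans_lt htN)
          · have : {x | t < s N x} = ∅ := by
              ext x
              simp only [hs, Set.mem_ofPred_eq, lt_min_iff, htN, and_false, Set.mem_empty_iff_false]
            rw [this, measure_empty]
            exact zero_le
        refine (mul_le_mul' h1 le_rfl).trans (le_of_eq ?_)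
        rw [ENNReal.ofReal_mul hA.le, mul_assoc, mul_assoc, mul_left_comm (ENNReal.ofReal t),
          ← ENNReal.ofReal_mul ht0.le]
        congr 4
        rw [mul_comm, ← Real.rpow_add_one ht0.ne']
        ring_nf
      refine (setLIntegral_mono' measurableSet_Ioi hpt).trans ?_
      rw [lintegral_const_mul' _ _ ENNReal.ofReal_ne_top]
      have hlc := lintegral_rpow_eq_lintegral_meas_lt_mul μ (f := fun x => s N x / η)
        (Eventually.of_forall fun x => div_nonneg (hs0 N x) hη.le)
        ((hsm N).div_const η).aemeasurable (p := 1 + ε) (by linarith)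
      have h2 : ∫⁻ t in Set.Ioi m, μ {x | t < s N x / η} * ENNReal.ofReal (t ^ (1 + ε - 1)) ≤
          ∫⁻ x, ENNReal.ofReal ((s N x / η) ^ (1 + ε)) ∂μ := by
        rw [hlc]
        refine (lintegral_mono_set (Set.Ioi_subset_Ioi hm)).trans ?_
        refine le_mul_of_one_le_left zero_le ?_
        rw [ENNReal.one_le_ofReal]
        linarith
      have h3 : ∫⁻ x, ENNReal.ofReal ((s N x / η) ^ (1 + ε)) ∂μ ≤
          ENNReal.ofReal ((η ^ 2)⁻¹) * I := by
        rw [hI, hν, lintegral_withDensity_eq_lintegral_mul _ hσ.ennreal_ofReal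
          ((hsm N).pow_const ε).ennreal_ofReal, ← lintegral_const_mul' _ _ ENNReal.ofReal_ne_top]
        refine lintegral_mono fun x => ?_
        simp only [Pi.mul_apply]
        rw [← ENNReal.ofReal_mul (hσ0 x), ← ENNReal.ofReal_mul (by positivity)]
        refine ENNReal.ofReal_le_ofReal ?_
        rw [Real.div_rpow (hs0 N x) hη.le, div_eq_inv_mul]
        have e1 : s N x ^ (1 + ε) ≤ σ x * s N x ^ ε := by
          rw [add_comm, Real.rpow_add_one' (hs0 N x) (by linarith), mul_comm]
          exact mul_le_mul_of_nonneg_right (min_le_left _ _) (Real.rpow_nonneg (hs0 N x) _)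
        have e2 : η ^ 2 ≤ η ^ (1 + ε) := by
          rw [← Real.rpow_two]
          exact Real.rpow_le_rpow_of_exponent_ge hη hη1 (by linarith)
        have := Real.rpow_nonneg (hs0 N x) (1 + ε)
        gcongr
      calc _ ≤ ENNReal.ofReal A * (ENNReal.ofReal ((η ^ 2)⁻¹) * I) :=
            mul_le_mul' le_rfl (h2.trans h3)
        _ = _ := by rw [← mul_assoc, ← ENNReal.ofReal_mul hA.le]
    have hmain : I ≤ ENNReal.ofReal (m ^ ε) * ν Set.univ + ENNReal.ofReal (1 / 2) * I := by
      calc I ≤ ENNReal.ofReal ε * (ν Set.univ * ENNReal.ofReal (m ^ ε / ε) +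
            ENNReal.ofReal (A * (η ^ 2)⁻¹) * I) := by
            conv_lhs => rw [hI2, hsplit]
            refine mul_le_mul' le_rfl ((lintegral_union_le _ _ _).trans (add_le_add hlow hhigh))
        _ = ENNReal.ofReal (ε * (m ^ ε / ε)) * ν Set.univ +
            ENNReal.ofReal (ε * (A * (η ^ 2)⁻¹)) * I := by
            rw [mul_add, ENNReal.ofReal_mul hε.le, ENNReal.ofReal_mul hε.le]
            ring
        _ ≤ _ := by
            rw [mul_div_cancel₀ _ hε.ne', ← mul_assoc]
            gcongr
    have hhalf : I = ENNReal.ofReal (1 / 2) * I + ENNReal.ofReal (1 / 2) * I := by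
      rw [← add_mul, ← ENNReal.ofReal_add (by norm_num) (by norm_num)]
      norm_num
    have hle : ENNReal.ofReal (1 / 2) * I ≤ ENNReal.ofReal (m ^ ε) * ν Set.univ := by
      have h5 := hmain
      conv_lhs at h5 => rw [hhalf]
      exact (ENNReal.add_le_add_iff_right
        (ENNReal.mul_ne_top ENNReal.ofReal_ne_top hIfin)).1 h5
    rw [hhalf, two_mul]
    exact add_le_add hle hle
  have hlim : Tendsto (fun N => ∫⁻ x, ENNReal.ofReal (s N x ^ ε) ∂ν) atTop
      (nhds (∫⁻ x, ENNReal.ofReal (σ x ^ ε) ∂ν)) := by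
    refine lintegral_tendsto_of_tendsto_of_monotone
      (fun N => ((hsm N).pow_const ε).ennreal_ofReal.aemeasurable)
      (Eventually.of_forall fun x N M hNM => ?_) (Eventually.of_forall fun x => ?_)
    · refine ENNReal.ofReal_le_ofReal (Real.rpow_le_rpow (hs0 N x) ?_ hε.le)
      exact min_le_min_left _ (by exact_mod_cast hNM)
    · refine tendsto_const_nhds.congr' ?_
      filter_upwards [eventually_ge_atTop ⌈σ x⌉₊] with N hN
      rw [hs]
      simp only
      rw [min_eq_left ((Nat.le_ceil _).trans (by exact_mod_cast hN))]
  have hfinal := le_of_tendsto' hlim htrunc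
  refine le_trans (le_of_eq ?_) hfinal
  rw [hν, lintegral_withDensity_eq_lintegral_mul _ hσ.ennreal_ofReal
    (hσ.pow_const ε).ennreal_ofReal]
  refine lintegral_congr fun x => ?_
  simp only [Pi.mul_apply]
  rw [← ENNReal.ofReal_mul (hσ0 x), add_comm, Real.rpow_add_one' (hσ0 x) (by linarith), mul_comm]

/-- **Reverse Hölder inequality**, with exponent depending only on the large subset constant. -/
theorem exists_reverseHolder (n : ℕ) {θ : ℝ} (hθ : 0 < θ) :
    ∃ ε : ℝ, 0 < ε ∧ ∀ σ : EuclideanSpace ℝ (Fin n) → ℝ, Measurable σ → (∀ x, 0 ≤ σ x) →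
      (∀ c r, (volume.withDensity fun x => ENNReal.ofReal (σ x)) (ball c r) < ⊤) →
      LargeSubsetBound θ ((1 / 2) ^ (n + 1))
        (volume.withDensity fun x => ENNReal.ofReal (σ x)) →
      ∀ c r, 0 < r → ⨍⁻ x in ball c r, ENNReal.ofReal (σ x ^ (1 + ε)) ∂volume ≤
        2 * (⨍⁻ x in ball c r, ENNReal.ofReal (σ x) ∂volume) ^ (1 + ε) := by
  set θ' := min θ 1 with hθ'
  have hθ0 : 0 < θ' := lt_min hθ one_pos
  set A : ℝ := 10 ^ (n + 1) with hA
  have hA0 : 0 < A := by positivity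
  set η := θ' / 2 with hη
  have hη0 : 0 < η := by positivity
  have hη1 : η ≤ 1 := by linarith [min_le_right θ 1]
  set ε := min 1 (1 / 2 / (A * (η ^ 2)⁻¹)) with hε
  have hε0 : 0 < ε := lt_min one_pos (by positivity)
  have hεA : ε * A * (η ^ 2)⁻¹ ≤ 1 / 2 := by
    rw [mul_assoc, ← le_div_iff₀ (by positivity)]
    exact min_le_right _ _
  refine ⟨ε, hε0, fun σ hσ hσ0 hfin H c r hr => ?_⟩
  have H' : LargeSubsetBound θ' ((1 / 2) ^ (n + 1))
      (volume.withDensity fun x => ENNReal.ofReal (σ x)) := by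
    intro c r hr F hF hFB hle
    refine le_trans ?_ (H c r hr F hF hFB hle)
    gcongr
    exact min_le_left _ _
  set ν := volume.withDensity fun x => ENNReal.ofReal (σ x) with hν
  set V := volume (ball c r) with hV
  have hV0 : V ≠ 0 := (measure_ball_pos volume c hr).ne'
  have hVt : V ≠ ⊤ := measure_ball_lt_top.ne
  have hνB : ν (ball c r) ≠ ⊤ := (hfin c r).ne
  set m := (ν (ball c r) / V).toReal with hm
  have hmV : ENNReal.ofReal m = ν (ball c r) / V :=
    ENNReal.ofReal_toReal (ENNReal.div_ne_top hνB hV0)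
  have hres : ((volume.restrict (ball c r)).withDensity fun x => ENNReal.ofReal (σ x)) =
      ν.restrict (ball c r) := (restrict_withDensity measurableSet_ball _).symm
  have key := lintegral_rpow_le_of_superlevel (μ := volume.restrict (ball c r)) hσ hσ0
    (by rw [hres, Measure.restrict_apply_univ]; exact hfin c r) hA0 hη0 hη1 hε0 (min_le_left _ _)
    hεA (m := m) ENNReal.toReal_nonneg (fun l hl => by
      rw [hres, Measure.restrict_apply (measurableSet_lt measurable_const hσ),
        Measure.restrict_apply (measurableSet_lt measurable_const hσ), Set.inter_comm,
        Set.inter_comm _ (ball c r)]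
      refine measure_superlevel_le hθ0 hσ hfin H' hr (ENNReal.toReal_nonneg.trans_lt hl) ?_
      rw [← ENNReal.div_le_iff hV0 hVt, ← hmV]
      exact ENNReal.ofReal_le_ofReal hl.le)
  rw [hres, Measure.restrict_apply_univ] at key
  rw [setLAverage_eq, setLAverage_eq,
    ← withDensity_apply (fun x => ENNReal.ofReal (σ x)) measurableSet_ball, ← hν, ← hmV]
  refine (ENNReal.div_le_div_right key _).trans (le_of_eq ?_)
  rw [ENNReal.ofReal_rpow_of_nonneg ENNReal.toReal_nonneg (by linarith), add_comm 1 ε,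
    Real.rpow_add_one' ENNReal.toReal_nonneg (by linarith),
    ENNReal.ofReal_mul (by positivity), hmV, mul_div_assoc, mul_div_assoc]

end ReverseHolder

section LargeSubset

variable {n : ℕ}

local notation "𝔼" => EuclideanSpace ℝ (Fin n)

/-- A Muckenhoupt type duality bound forces the dual weight to charge large subsets of balls. -/
lemma largeSubsetBound_of_duality {φ : ℝ → ℝ} (hφ : MonotoneOn φ (Set.Ici 0))
    (hφ0 : ∀ t, 0 < t → 0 < φ t) {C κ L : ℝ} (hC : 0 < C) (hκ : 0 < κ) (hL : 0 < L)
    (hφL : ∀ a b, 0 ≤ a → 0 ≤ b → φ a ≤ 2 * C / κ * φ b → a ≤ L * b)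
    {σ w : 𝔼 → ℝ} (hσ : Measurable σ) (hσ0 : ∀ x, 0 ≤ σ x) (hw : ∀ x, 0 < w x)
    (hdual : ∀ x, 1 ≤ w x * φ (σ x))
    (hfin : ∀ c r, (volume.withDensity fun x => ENNReal.ofReal (σ x)) (ball c r) < ⊤)
    (H : ∀ c r, 0 < r → (⨍⁻ x in ball c r, ENNReal.ofReal (w x) ∂volume) *
      ENNReal.ofReal (φ (⨍⁻ x in ball c r, ENNReal.ofReal (σ x) ∂volume).toReal) ≤
        ENNReal.ofReal C) :
    LargeSubsetBound (κ / (4 * L)) κ (volume.withDensity fun x => ENNReal.ofReal (σ x)) := by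
  intro c r hr F hF hFB hle
  set ν := volume.withDensity fun x => ENNReal.ofReal (σ x) with hν
  by_contra! hlt
  have hV0 : volume (ball c r) ≠ 0 := (measure_ball_pos volume c hr).ne'
  have hVt : volume (ball c r) ≠ ⊤ := measure_ball_lt_top.ne
  have hFt : volume F ≠ ⊤ := ne_top_of_le_ne_top hVt (measure_mono hFB)
  have hb0 : ν (ball c r) ≠ 0 := by
    intro h0
    rw [h0, mul_zero] at hlt
    exact not_lt_zero hlt
  obtain ⟨v, hv⟩ : ∃ v, v = (volume (ball c r)).toReal := ⟨_, rfl⟩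
  obtain ⟨b, hb⟩ : ∃ b, b = (ν (ball c r)).toReal := ⟨_, rfl⟩
  obtain ⟨f, hf⟩ : ∃ f, f = (volume F).toReal := ⟨_, rfl⟩
  have hvE : volume (ball c r) = ENNReal.ofReal v := by rw [hv, ENNReal.ofReal_toReal hVt]
  have hbE : ν (ball c r) = ENNReal.ofReal b := by rw [hb, ENNReal.ofReal_toReal (hfin c r).ne]
  have hfE : volume F = ENNReal.ofReal f := by rw [hf, ENNReal.ofReal_toReal hFt]
  have hv0 : 0 < v := hv ▸ ENNReal.toReal_pos hV0 hVt
  have hbpos : 0 < b := hb ▸ ENNReal.toReal_pos hb0 (hfin c r).ne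
  have hκf : κ * v ≤ f := by
    rw [hvE, hfE, ← ENNReal.ofReal_mul hκ.le] at hle
    exact (ENNReal.ofReal_le_ofReal_iff (hf ▸ ENNReal.toReal_nonneg)).1 hle
  have hf0 : 0 < f := (mul_pos hκ hv0).trans_le hκf
  set θ := κ / (4 * L) with hθ
  have hθ0 : 0 < θ := by positivity
  set M := θ * b / f with hM
  have hM0 : 0 < M := by positivity
  have hbad : volume (F ∩ {x | 2 * M ≤ σ x}) ≤ ENNReal.ofReal (f / 2) := by
    have h1 := mul_meas_ge_le_lintegral (μ := volume.restrict F) hσ.ennreal_ofReal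
      (ENNReal.ofReal (2 * M))
    have h2 : volume (F ∩ {x | 2 * M ≤ σ x}) ≤
        (volume.restrict F) {x | ENNReal.ofReal (2 * M) ≤ ENNReal.ofReal (σ x)} := by
      rw [Set.inter_comm, ← Measure.restrict_apply (measurableSet_le measurable_const hσ)]
      exact measure_mono fun x hx => ENNReal.ofReal_le_ofReal hx
    rw [← withDensity_apply _ hF, ← hν] at h1
    have h3 := (mul_le_mul' le_rfl h2).trans (h1.trans hlt.le)
    rw [hbE, ← ENNReal.ofReal_mul hθ0.le] at h3
    have h4 : θ * b = 2 * M * (f / 2) := by rw [hM]; field_simp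
    rw [h4, ENNReal.ofReal_mul (p := 2 * M) (by positivity)] at h3
    exact (ENNReal.mul_le_mul_iff_right (ENNReal.ofReal_pos.2 (by positivity)).ne'
      ENNReal.ofReal_ne_top).1 h3
  set G := F ∩ {x | σ x < 2 * M} with hG
  have hGm : MeasurableSet G := hF.inter (measurableSet_lt hσ measurable_const)
  have hGf : ENNReal.ofReal (f / 2) ≤ volume G := by
    have h1 : volume F ≤ volume G + volume (F ∩ {x | 2 * M ≤ σ x}) := by
      refine (measure_mono fun x hx => ?_).trans (measure_union_le _ _)
      rcases lt_or_ge (σ x) (2 * M) with h | h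
      · exact Or.inl ⟨hx, h⟩
      · exact Or.inr ⟨hx, h⟩
    have h2 := h1.trans (add_le_add le_rfl hbad)
    rw [hfE, show f = f / 2 + f / 2 by ring, ENNReal.ofReal_add (by positivity) (by positivity),
      ← show f = f / 2 + f / 2 by ring] at h2
    exact (ENNReal.add_le_add_iff_right ENNReal.ofReal_ne_top).1 h2
  have hφM : 0 < φ (2 * M) := hφ0 _ (by positivity)
  have hwG : ENNReal.ofReal (κ / (2 * φ (2 * M))) ≤
      ⨍⁻ x in ball c r, ENNReal.ofReal (w x) ∂volume := by
    rw [setLAverage_eq, ENNReal.le_div_iff_mul_le (Or.inl hV0) (Or.inl hVt)]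
    calc ENNReal.ofReal (κ / (2 * φ (2 * M))) * volume (ball c r)
        ≤ ENNReal.ofReal (1 / φ (2 * M)) * ENNReal.ofReal (f / 2) := by
          rw [hvE, ← ENNReal.ofReal_mul (by positivity), ← ENNReal.ofReal_mul (by positivity)]
          refine ENNReal.ofReal_le_ofReal ?_
          rw [div_mul_eq_mul_div, div_mul_div_comm, one_mul, mul_comm (φ _)]
          gcongr
      _ ≤ ENNReal.ofReal (1 / φ (2 * M)) * volume G := by gcongr
      _ = ∫⁻ x in G, ENNReal.ofReal (1 / φ (2 * M)) := (setLIntegral_const _ _).symm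
      _ ≤ ∫⁻ x in G, ENNReal.ofReal (w x) := by
          refine setLIntegral_mono' hGm fun x hx => ENNReal.ofReal_le_ofReal ?_
          rw [div_le_iff₀ hφM]
          refine (hdual x).trans (mul_le_mul_of_nonneg_left ?_ (hw x).le)
          exact hφ (hσ0 x) (Set.mem_Ici.2 (by positivity)) (le_of_lt hx.2)
      _ ≤ _ := lintegral_mono_set (Set.inter_subset_left.trans hFB)
  have hav : (⨍⁻ x in ball c r, ENNReal.ofReal (σ x) ∂volume).toReal = b / v := by
    rw [setLAverage_eq, ← withDensity_apply _ measurableSet_ball, ENNReal.toReal_div, ← hb, ← hv]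
  have h1 := (mul_le_mul' hwG le_rfl).trans (H c r hr)
  rw [hav, ← ENNReal.ofReal_mul (by positivity), ENNReal.ofReal_le_ofReal_iff hC.le,
    div_mul_eq_mul_div, div_le_iff₀ (by positivity)] at h1
  have h2 := hφL (b / v) (2 * M) (by positivity) (by positivity) (by
    rw [div_mul_eq_mul_div, le_div_iff₀ hκ]
    linarith)
  have h3 : L * (2 * M) = κ * b / (2 * f) := by rw [hM, hθ]; field_simp; norm_num
  rw [h3, div_le_div_iff₀ hv0 (by positivity)] at h2
  nlinarith [mul_pos hbpos hf0, mul_le_mul_of_nonneg_left hκf hbpos.le]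

end LargeSubset

/-! ### From `A_Φ` to `A_{i(Φ)}` -/

/-- A weak type bound with exponent larger than one controls the integral. -/
lemma lintegral_le_of_measure_lt_le {X : Type*} [MeasurableSpace X] {μ : Measure X}
    [IsFiniteMeasure μ] {f : X → ℝ} (hf : Measurable f) (hf0 : ∀ x, 0 ≤ f x) {a ε : ℝ}
    (ha : 0 < a) (hε : 0 < ε)
    (H : ∀ t, 0 < t → μ {x | t < f x} ≤ ENNReal.ofReal (2 * (a / t) ^ (1 + ε)) * μ Set.univ) :
    ∫⁻ x, ENNReal.ofReal (f x) ∂μ ≤ ENNReal.ofReal ((1 + 2 / ε) * a) * μ Set.univ := by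
  rw [lintegral_eq_lintegral_meas_lt μ (Eventually.of_forall hf0) hf.aemeasurable,
    ← Set.Ioc_union_Ioi_eq_Ioi ha.le]
  refine (lintegral_union_le _ _ _).trans ?_
  have h1 : ∫⁻ t in Set.Ioc 0 a, μ {x | t < f x} ≤ ENNReal.ofReal a * μ Set.univ := by
    refine (lintegral_mono fun t => measure_mono (Set.subset_univ _)).trans (le_of_eq ?_)
    rw [setLIntegral_const, Real.volume_Ioc, sub_zero, mul_comm]
  have h2 : ∫⁻ t in Set.Ioi a, μ {x | t < f x} ≤ ENNReal.ofReal (2 / ε * a) * μ Set.univ := by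
    have hlt : -(1 + ε) < -1 := by linarith
    have hInteg := (integrableOn_Ioi_rpow_of_lt hlt ha).const_mul (2 * a ^ (1 + ε))
    have hval : ∫⁻ t in Set.Ioi a, ENNReal.ofReal (2 * a ^ (1 + ε) * t ^ (-(1 + ε))) =
        ENNReal.ofReal (2 / ε * a) := by
      rw [← ofReal_integral_eq_lintegral_ofReal hInteg
        ((ae_restrict_iff' measurableSet_Ioi).2 (Eventually.of_forall fun t ht =>
          mul_nonneg (by positivity) (Real.rpow_nonneg (ha.trans ht).le _))),
        integral_const_mul, integral_Ioi_rpow_of_lt hlt ha]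
      congr 1
      have e1 : -(1 + ε) + 1 = -ε := by ring
      rw [e1, Real.rpow_neg ha.le, Real.rpow_add ha, Real.rpow_one]
      have := Real.rpow_pos_of_pos ha ε
      field_simp
    rw [← hval, ← lintegral_mul_const' _ _ (measure_ne_top μ _)]
    refine setLIntegral_mono' measurableSet_Ioi fun t ht => ?_
    have ht0 : 0 < t := ha.trans ht
    refine (H t ht0).trans (le_of_eq ?_)
    rw [Real.div_rpow ha.le ht0.le, Real.rpow_neg ht0.le, div_eq_mul_inv, mul_assoc]
  refine (add_le_add h1 h2).trans (le_of_eq ?_)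
  rw [← add_mul, ← ENNReal.ofReal_add ha.le (by positivity)]
  ring_nf

section APhiToAp

variable {n : ℕ} {Φ : NFunction} {ω : EuclideanSpace ℝ (Fin n) → ℝ}

local notation "𝔼" => EuclideanSpace ℝ (Fin n)

lemma lintegral_ball_ofReal_lt_top (hloc : LocallyIntegrable ω volume) (c : 𝔼) (r : ℝ) :
    ∫⁻ x in ball c r, ENNReal.ofReal (ω x) < ⊤ := by
  have h : IntegrableOn ω (ball c r) volume :=
    (hloc.integrableOn_isCompact (isCompact_closedBall c r)).mono_set ball_subset_closedBall
  exact (lintegral_mono fun x => Real.ofReal_le_enorm _).trans_lt h.2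

lemma lintegral_ball_ofReal_pos (hω : Measurable ω) (hpos : ∀ x, 0 < ω x) (c : 𝔼) {r : ℝ}
    (hr : 0 < r) : 0 < ∫⁻ x in ball c r, ENNReal.ofReal (ω x) := by
  rw [setLIntegral_pos_iff hω.ennreal_ofReal]
  have : Function.support (fun x => ENNReal.ofReal (ω x)) = Set.univ := by
    ext x
    simp [hpos x]
  rw [this, Set.univ_inter]
  exact measure_ball_pos volume c hr

lemma laverage_ball_ofReal_ne_top (hloc : LocallyIntegrable ω volume) (c : 𝔼) {r : ℝ}
    (hr : 0 < r) : ⨍⁻ x in ball c r, ENNReal.ofReal (ω x) ∂volume ≠ ⊤ := by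
  rw [setLAverage_eq]
  exact ENNReal.div_ne_top (lintegral_ball_ofReal_lt_top hloc c r).ne
    (measure_ball_pos volume c hr).ne'

lemma laverage_ball_ofReal_ne_zero (hω : Measurable ω) (hpos : ∀ x, 0 < ω x) (c : 𝔼) {r : ℝ}
    (hr : 0 < r) : ⨍⁻ x in ball c r, ENNReal.ofReal (ω x) ∂volume ≠ 0 := by
  rw [setLAverage_eq]
  exact (ENNReal.div_pos (lintegral_ball_ofReal_pos hω hpos c hr).ne' measure_ball_lt_top.ne).ne'

lemma laverage_const_mul {δ : ℝ} (hδ : 0 < δ) (c : 𝔼) (r : ℝ) :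
    ⨍⁻ x in ball c r, ENNReal.ofReal (δ * ω x) ∂volume =
      ENNReal.ofReal δ * ⨍⁻ x in ball c r, ENNReal.ofReal (ω x) ∂volume := by
  simp_rw [setLAverage_eq, ENNReal.ofReal_mul hδ.le]
  rw [lintegral_const_mul' _ _ ENNReal.ofReal_ne_top, mul_div_assoc]

/-- Self-improved `A_Φ` condition tested on sublevel sets of the weight. -/
lemma MemAPhi.exists_laverage_mul_der_le (hΦc : Delta2On Φ.conj) (hω : Measurable ω)
    (hpos : ∀ x, 0 < ω x) (h : MemAPhi Φ ω) :
    ∃ ε C : ℝ, 0 < ε ∧ 0 < C ∧ ∀ (c : 𝔼) (r s t : ℝ), 0 < r → 0 < s → 0 < t →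
      (⨍⁻ x in ball c r, ENNReal.ofReal (ω x) ∂volume).toReal *
        Φ.der (((volume (ball c r ∩ {x | ω x < s}) / volume (ball c r)).toReal / 2) ^
          (1 / (1 + ε)) * t) ≤ C * s * Φ.der t := by
  obtain ⟨C', hC't, hC'⟩ := h
  set C := C'.toReal + 1 with hCdef
  have hC0 : 0 < C := by positivity
  have hCC : C' ≤ ENNReal.ofReal C := by
    rw [← ENNReal.ofReal_toReal hC't]
    exact ENNReal.ofReal_le_ofReal (by linarith)
  set κ : ℝ := (1 / 2) ^ (n + 1) with hκ
  have hκ0 : 0 < κ := by positivity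
  obtain ⟨L, hL1, hL⟩ := Φ.exists_le_mul_of_der_le hΦc (2 * C / κ)
  have hL0 : 0 < L := by linarith
  obtain ⟨ε, hε, hRH⟩ := exists_reverseHolder n (θ := κ / (4 * L)) (by positivity)
  refine ⟨ε, C, hε, hC0, fun c r s t hr hs ht => ?_⟩
  have hdt := Φ.der_pos t ht
  set δ := 1 / (s * Φ.der t) with hδ
  have hδ0 : 0 < δ := by positivity
  set σ : 𝔼 → ℝ := fun x => Φ.invDer (1 / (δ * ω x)) with hσdef
  have hσ : Measurable σ :=
    Φ.monotone_invDer.measurable.comp (measurable_const.div (measurable_const.mul hω))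
  have hσ0 : ∀ x, 0 ≤ σ x := fun x => Φ.invDer_nonneg _
  have hw0 : ∀ x, 0 < δ * ω x := fun x => mul_pos hδ0 (hpos x)
  have havt : ∀ c r, 0 < r → ⨍⁻ x in ball c r, ENNReal.ofReal (σ x) ∂volume ≠ ⊤ := by
    intro c r hr htop
    have h1 := hC' δ hδ0 c r hr
    rw [show (fun x => ENNReal.ofReal (Φ.invDer (1 / (δ * ω x)))) =
      fun x => ENNReal.ofReal (σ x) from rfl, htop, NFunction.derE, if_pos rfl,
      ENNReal.mul_top (laverage_ball_ofReal_ne_zero (ω := fun x => δ * ω x)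
        (measurable_const.mul hω) hw0 c hr)] at h1
    exact hC't (top_le_iff.1 h1)
  have hfin : ∀ c r, (volume.withDensity fun x => ENNReal.ofReal (σ x)) (ball c r) < ⊤ := by
    intro c r
    rcases le_or_gt r 0 with hr | hr
    · simp [ball_eq_empty.2 hr]
    · rw [withDensity_apply _ measurableSet_ball, lt_top_iff_ne_top]
      intro htop
      refine havt c r hr ?_
      rw [setLAverage_eq, htop, ENNReal.top_div_of_ne_top measure_ball_lt_top.ne]
  have hAC : ∀ c r, 0 < r → (⨍⁻ x in ball c r, ENNReal.ofReal (δ * ω x) ∂volume) *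
      ENNReal.ofReal (Φ.der (⨍⁻ x in ball c r, ENNReal.ofReal (σ x) ∂volume).toReal) ≤
        ENNReal.ofReal C := by
    intro c r hr
    have h1 := (hC' δ hδ0 c r hr).trans hCC
    rwa [NFunction.derE, if_neg (havt c r hr)] at h1
  have hlarge := largeSubsetBound_of_duality Φ.der_mono Φ.der_pos hC0 hκ0 hL0 hL hσ hσ0 hw0
    (fun x => by
      have := Φ.le_der_invDer (1 / (δ * ω x))
      rwa [div_le_iff₀ (hw0 x), mul_comm] at this) hfin hAC
  have hrh := hRH σ hσ hσ0 hfin hlarge c r hr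
  set S := ball c r ∩ {x | ω x < s} with hS
  have hSm : MeasurableSet S := measurableSet_ball.inter (measurableSet_lt hω measurable_const)
  have hV0 : volume (ball c r) ≠ 0 := (measure_ball_pos volume c hr).ne'
  have hVt : volume (ball c r) ≠ ⊤ := measure_ball_lt_top.ne
  set u := (volume S / volume (ball c r)).toReal with hu
  have hut : volume S / volume (ball c r) ≠ ⊤ :=
    ENNReal.div_ne_top (ne_top_of_le_ne_top hVt (measure_mono Set.inter_subset_left)) hV0
  set a := (⨍⁻ x in ball c r, ENNReal.ofReal (σ x) ∂volume).toReal with ha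
  have ha0 : 0 ≤ a := ENNReal.toReal_nonneg
  have hlow : ENNReal.ofReal (u * t ^ (1 + ε)) ≤ ENNReal.ofReal (2 * a ^ (1 + ε)) := by
    calc ENNReal.ofReal (u * t ^ (1 + ε))
        = ENNReal.ofReal (t ^ (1 + ε)) * volume S / volume (ball c r) := by
          rw [mul_comm u, ENNReal.ofReal_mul (by positivity), hu, ENNReal.ofReal_toReal hut,
            mul_div_assoc]
      _ ≤ ⨍⁻ x in ball c r, ENNReal.ofReal (σ x ^ (1 + ε)) ∂volume := by
          rw [setLAverage_eq]
          refine ENNReal.div_le_div_right ?_ _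
          rw [← setLIntegral_const]
          refine (setLIntegral_mono' hSm fun x hx => ?_).trans
            (lintegral_mono_set Set.inter_subset_left)
          refine ENNReal.ofReal_le_ofReal (Real.rpow_le_rpow ht.le ?_ (by linarith))
          refine Φ.le_invDer ht.le ?_
          have hxs : ω x < s := hx.2
          rw [le_div_iff₀ (hw0 x), hδ, one_div, ← div_eq_inv_mul, ← mul_div_assoc,
            div_le_iff₀ (by positivity), one_mul, mul_comm s]
          exact mul_le_mul_of_nonneg_left hxs.le hdt.le
      _ ≤ _ := hrh
      _ = _ := by
          rw [ENNReal.ofReal_mul (by norm_num), ← ENNReal.ofReal_rpow_of_nonneg ha0 (by linarith),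
            ha, ENNReal.ofReal_toReal (havt c r hr)]
          norm_num
  have hu0 : 0 ≤ u := ENNReal.toReal_nonneg
  have hlow' : (u / 2) ^ (1 / (1 + ε)) * t ≤ a := by
    rw [ENNReal.ofReal_le_ofReal_iff (by positivity)] at hlow
    have h1 : u / 2 * t ^ (1 + ε) ≤ a ^ (1 + ε) := by linarith
    have h2 := Real.rpow_le_rpow (by positivity) h1 (by positivity : 0 ≤ 1 / (1 + ε))
    rw [Real.mul_rpow (by positivity) (by positivity), ← Real.rpow_mul ht.le,
      ← Real.rpow_mul ha0, mul_one_div_cancel (by linarith), Real.rpow_one, Real.rpow_one] at h2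
    exact h2
  have hder : Φ.der ((u / 2) ^ (1 / (1 + ε)) * t) ≤ Φ.der a :=
    Φ.der_le_der (by positivity) hlow'
  have h1 := hAC c r hr
  rw [laverage_const_mul hδ0, ← ha] at h1
  have h2 := ENNReal.toReal_mono ENNReal.ofReal_ne_top h1
  rw [ENNReal.toReal_mul, ENNReal.toReal_mul, ENNReal.toReal_ofReal hδ0.le,
    ENNReal.toReal_ofReal (Φ.der_nonneg _), ENNReal.toReal_ofReal hC0.le] at h2
  set W := (⨍⁻ x in ball c r, ENNReal.ofReal (ω x) ∂volume).toReal with hW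
  have hW0 : 0 ≤ W := ENNReal.toReal_nonneg
  have h3 : W * Φ.der a ≤ C * s * Φ.der t := by
    rw [hδ, one_div, ← div_eq_inv_mul, div_mul_eq_mul_div, div_le_iff₀ (by positivity)] at h2
    linarith
  exact (mul_le_mul_of_nonneg_left hder hW0).trans h3

lemma MemAPhi.memMuckenhoupt (hΦ : Delta2On Φ.toFun) (hΦc : Delta2On Φ.conj) (hω : Measurable ω)
    (hpos : ∀ x, 0 < ω x) (hloc : LocallyIntegrable ω volume) (h : MemAPhi Φ ω) :
    MemMuckenhoupt Φ.lowerIndex ω := by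
  have hp := Φ.one_lt_lowerIndex hΦ hΦc
  set p := Φ.lowerIndex with hpdef
  have hp1 : 0 < p - 1 := by linarith
  obtain ⟨ε, C, hε, hC, H⟩ := h.exists_laverage_mul_der_le hΦc hω hpos
  obtain ⟨K, hK, hΦK⟩ := hΦ
  set D := 2 * C * K with hD
  have hD0 : 0 < D := by positivity
  refine ⟨ENNReal.ofReal (D * (1 + 2 / ε) ^ (p - 1)), ENNReal.ofReal_ne_top, fun c r hr => ?_⟩
  have hV0 : volume (ball c r) ≠ 0 := (measure_ball_pos volume c hr).ne'
  have hVt : volume (ball c r) ≠ ⊤ := measure_ball_lt_top.ne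
  set W := (⨍⁻ x in ball c r, ENNReal.ofReal (ω x) ∂volume).toReal with hW
  have hWE : ⨍⁻ x in ball c r, ENNReal.ofReal (ω x) ∂volume = ENNReal.ofReal W := by
    rw [hW, ENNReal.ofReal_toReal (laverage_ball_ofReal_ne_top hloc c hr)]
  have hW0 : 0 < W := ENNReal.toReal_pos (laverage_ball_ofReal_ne_zero hω hpos c hr)
    (laverage_ball_ofReal_ne_top hloc c hr)
  have hweak : ∀ s, 0 < s → volume (ball c r ∩ {x | ω x < s}) ≤
      ENNReal.ofReal (2 * (D * s / W) ^ ((1 + ε) / (p - 1))) * volume (ball c r) := by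
    intro s hs
    set u := (volume (ball c r ∩ {x | ω x < s}) / volume (ball c r)).toReal with hu
    have hut : volume (ball c r ∩ {x | ω x < s}) / volume (ball c r) ≠ ⊤ :=
      ENNReal.div_ne_top (ne_top_of_le_ne_top hVt (measure_mono Set.inter_subset_left)) hV0
    rw [← ENNReal.div_le_iff hV0 hVt, ← ENNReal.ofReal_toReal hut, ← hu]
    refine ENNReal.ofReal_le_ofReal ?_
    have hu0 : 0 ≤ u := ENNReal.toReal_nonneg
    rcases hu0.eq_or_lt with hu0 | hu0
    · rw [← hu0]; positivity
    have hu1 : u ≤ 1 := by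
      refine ENNReal.toReal_le_of_le_ofReal zero_le_one ?_
      rw [ENNReal.ofReal_one]
      exact ENNReal.div_le_of_le_mul (by
        rw [one_mul]; exact measure_mono Set.inter_subset_left)
    set l := (u / 2) ^ (1 / (1 + ε)) with hl
    have hl0 : 0 < l := by positivity
    have hl1 : l ≤ 1 := Real.rpow_le_one (by positivity) (by linarith) (by positivity)
    obtain ⟨t, ht, hlt⟩ := Φ.exists_rpow_lowerIndex_le ⟨K, hK, hΦK⟩ hl0 hl1
    rw [← hpdef] at hlt
    have h1 : W * Φ.der (l * t) ≤ C * s * Φ.der t := H c r s t hr hs ht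
    have h2 : Φ.toFun (l * t) ≤ l * t * Φ.der (l * t) := Φ.toFun_le_mul_der (by positivity)
    have h3 : t * Φ.der t ≤ K * Φ.toFun t := (Φ.mul_der_le_toFun ht.le).trans (hΦK t ht.le)
    have hT := Φ.toFun_pos ht
    have h4 : W * (l ^ p / 2 * Φ.toFun t) ≤ l * (C * s * (K * Φ.toFun t)) := by
      calc W * (l ^ p / 2 * Φ.toFun t) ≤ W * (l * t * Φ.der (l * t)) := by
            exact mul_le_mul_of_nonneg_left (hlt.trans h2) hW0.le
        _ = l * t * (W * Φ.der (l * t)) := by ring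
        _ ≤ l * t * (C * s * Φ.der t) := by gcongr
        _ = l * (C * s * (t * Φ.der t)) := by ring
        _ ≤ _ := by gcongr
    have h5 : l ^ p = l ^ (p - 1) * l := by
      rw [← Real.rpow_add_one hl0.ne', sub_add_cancel]
    have h6 : l ^ (p - 1) ≤ D * s / W := by
      rw [le_div_iff₀ hW0]
      rw [h5] at h4
      have h7 : l * Φ.toFun t * (l ^ (p - 1) * W) ≤ l * Φ.toFun t * (D * s) := by
        rw [hD]; linarith
      exact le_of_mul_le_mul_left h7 (by positivity)
    have h8 := Real.rpow_le_rpow (by positivity) h6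
      (by positivity : 0 ≤ (1 + ε) / (p - 1))
    rw [← Real.rpow_mul hl0.le, mul_div_cancel₀ _ hp1.ne', hl, ← Real.rpow_mul (by positivity),
      one_div_mul_cancel (by linarith), Real.rpow_one] at h8
    linarith
  set a := (D / W) ^ (1 / (p - 1)) with ha
  have ha0 : 0 < a := by positivity
  have : IsFiniteMeasure (volume.restrict (ball c r)) := ⟨by
    rw [Measure.restrict_apply_univ]; exact measure_ball_lt_top⟩
  have hmain := lintegral_le_of_measure_lt_le (μ := volume.restrict (ball c r))
    (f := fun x => ω x ^ (-(1 / (p - 1)))) (hω.pow_const _)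
    (fun x => Real.rpow_nonneg (hpos x).le _) ha0 hε (fun t ht => by
      rw [Measure.restrict_apply (measurableSet_lt measurable_const (hω.pow_const _)),
        Measure.restrict_apply_univ, Set.inter_comm]
      have hset : ball c r ∩ {x | t < ω x ^ (-(1 / (p - 1)))} ⊆
          ball c r ∩ {x | ω x < t ^ (-(p - 1))} := by
        intro x hx
        refine ⟨hx.1, ?_⟩
        have hx2 : t < ω x ^ (-(1 / (p - 1))) := hx.2
        have h1 := Real.rpow_lt_rpow_of_neg ht hx2 (neg_neg_of_pos hp1)
        rw [← Real.rpow_mul (hpos x).le, neg_mul_neg, one_div_mul_cancel hp1.ne',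
          Real.rpow_one] at h1
        exact h1
      refine (measure_mono hset).trans ((hweak _ (by positivity)).trans (le_of_eq ?_))
      congr 3
      rw [ha, mul_div_right_comm, Real.mul_rpow (by positivity) (by positivity),
        Real.div_rpow (by positivity) ht.le, ← Real.rpow_mul ht.le,
        ← Real.rpow_mul (div_pos hD0 hW0).le, div_eq_mul_inv _ (t ^ (1 + ε)), ← Real.rpow_neg ht.le]
      congr 2 <;> field_simp)
  rw [Measure.restrict_apply_univ] at hmain
  have hav : ⨍⁻ x in ball c r, ENNReal.ofReal (ω x) ^ (-(1 / (p - 1))) ∂volume ≤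
      ENNReal.ofReal ((1 + 2 / ε) * a) := by
    rw [setLAverage_eq, ENNReal.div_le_iff hV0 hVt]
    refine le_trans (le_of_eq (lintegral_congr fun x => ?_)) hmain
    rw [ENNReal.ofReal_rpow_of_pos (hpos x)]
  rw [hWE]
  refine (mul_le_mul' le_rfl (ENNReal.rpow_le_rpow hav hp1.le)).trans (le_of_eq ?_)
  rw [ENNReal.ofReal_rpow_of_pos (by positivity), ← ENNReal.ofReal_mul hW0.le,
    Real.mul_rpow (by positivity) ha0.le, ha, ← Real.rpow_mul (by positivity),
    one_div_mul_cancel hp1.ne', Real.rpow_one]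
  congr 1
  field_simp

end APhiToAp

/-! ### From the modular maximal inequality to `A_Φ` -/

lemma NFunction.monotone_toFunE (Φ : NFunction) : Monotone Φ.toFunE := by
  intro s t hst
  unfold NFunction.toFunE
  by_cases ht : t = ⊤
  · rw [if_pos ht]; exact le_top
  · rw [if_neg ht, if_neg (ne_top_of_le_ne_top ht hst)]
    exact ENNReal.ofReal_le_ofReal (Φ.toFun_mono ENNReal.toReal_nonneg (ENNReal.toReal_mono ht hst))

lemma NFunction.toFunE_ofReal (Φ : NFunction) {t : ℝ} (ht : 0 ≤ t) :
    Φ.toFunE (ENNReal.ofReal t) = ENNReal.ofReal (Φ.toFun t) := by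
  rw [NFunction.toFunE, if_neg ENNReal.ofReal_ne_top, ENNReal.toReal_ofReal ht]

section ModularToAPhi

variable {n : ℕ} {Φ : NFunction} {ω : EuclideanSpace ℝ (Fin n) → ℝ}

local notation "𝔼" => EuclideanSpace ℝ (Fin n)

lemma le_maximalFn (g : 𝔼 → ℝ) {x c : 𝔼} {r : ℝ} (hr : 0 < r) (hx : x ∈ ball c r) :
    ⨍⁻ y in ball c r, ENNReal.ofReal |g y| ∂volume ≤ maximalFn g x :=
  le_iSup_of_le c (le_iSup_of_le r (le_iSup_of_le ⟨hr, hx⟩ le_rfl))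

/-- The modular inequality for the maximal function. -/
def ModularMaximalBound (Φ : NFunction) (ω : 𝔼 → ℝ) (C : ℝ) : Prop :=
  ∀ v : 𝔼 → ℝ, Measurable v →
    (∫⁻ x, ENNReal.ofReal (Φ.toFun |v x|) * ENNReal.ofReal (ω x) < ⊤) →
    ∫⁻ x, Φ.toFunE (maximalFn v x) * ENNReal.ofReal (ω x) ≤
      ENNReal.ofReal C * ∫⁻ x, ENNReal.ofReal (Φ.toFun |v x|) * ENNReal.ofReal (ω x)

/-- Testing the modular inequality on bounded truncations of the dual weight. -/
lemma ModularMaximalBound.mul_toFun_le {C : ℝ} (hC : 0 < C) (H : ModularMaximalBound Φ ω C)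
    (hω : Measurable ω) (hpos : ∀ x, 0 < ω x) (hloc : LocallyIntegrable ω volume)
    {A δ : ℝ} (hA : 0 < A) (hΦA : ∀ t, 0 ≤ t → Φ.der (Φ.invDer t) ≤ A * t) (hδ : 0 < δ)
    (c : 𝔼) {r : ℝ} (hr : 0 < r) (k : ℕ) {a : ℝ} (ha : 0 ≤ a)
    (hak : ⨍⁻ x in ball c r, ENNReal.ofReal (min (Φ.invDer (1 / (δ * ω x))) k) ∂volume =
      ENNReal.ofReal a) :
    δ * (⨍⁻ x in ball c r, ENNReal.ofReal (ω x) ∂volume).toReal * Φ.toFun a ≤ C * A * a := by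
  have hV0 : volume (ball c r) ≠ 0 := (measure_ball_pos volume c hr).ne'
  have hVt : volume (ball c r) ≠ ⊤ := measure_ball_lt_top.ne
  set g : 𝔼 → ℝ := fun x => min (Φ.invDer (1 / (δ * ω x))) k with hg
  have hgm : Measurable g := (Φ.monotone_invDer.measurable.comp
    (measurable_const.div (measurable_const.mul hω))).min measurable_const
  have hg0 : ∀ x, 0 ≤ g x := fun x => le_min (Φ.invDer_nonneg _) k.cast_nonneg
  set v : 𝔼 → ℝ := (ball c r).indicator g with hv
  have hvm : Measurable v := hgm.indicator measurableSet_ball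
  have hva : ∀ x ∈ ball c r, |v x| = g x := fun x hx => by
    rw [hv, Set.indicator_of_mem hx, abs_of_nonneg (hg0 x)]
  have hI : ∫⁻ x in ball c r, ENNReal.ofReal (g x) =
      ENNReal.ofReal a * volume (ball c r) := by
    rw [← hak, setLAverage_eq, ENNReal.div_mul_cancel hV0 hVt]
  have hup : ∫⁻ x, ENNReal.ofReal (Φ.toFun |v x|) * ENNReal.ofReal (ω x) ≤
      ENNReal.ofReal (A / δ) * (ENNReal.ofReal a * volume (ball c r)) := by
    have h0 : (fun x => ENNReal.ofReal (Φ.toFun |v x|) * ENNReal.ofReal (ω x)) =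
        (ball c r).indicator fun x => ENNReal.ofReal (Φ.toFun (g x)) * ENNReal.ofReal (ω x) := by
      ext x
      by_cases hx : x ∈ ball c r
      · rw [Set.indicator_of_mem hx, hva x hx]
      · rw [Set.indicator_of_notMem hx, hv, Set.indicator_of_notMem hx, abs_zero, Φ.toFun_zero,
          ENNReal.ofReal_zero, zero_mul]
    rw [h0, lintegral_indicator measurableSet_ball, ← hI,
      ← lintegral_const_mul' _ _ ENNReal.ofReal_ne_top]
    refine lintegral_mono fun x => ?_
    rw [← ENNReal.ofReal_mul (Φ.toFun_nonneg (hg0 x)), ← ENNReal.ofReal_mul (by positivity)]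
    refine ENNReal.ofReal_le_ofReal ?_
    have hx := hpos x
    have h1 : Φ.der (g x) ≤ A * (1 / (δ * ω x)) :=
      (Φ.der_le_der (hg0 x) (min_le_left _ _)).trans (hΦA _ (by positivity))
    calc Φ.toFun (g x) * ω x ≤ g x * Φ.der (g x) * ω x :=
          mul_le_mul_of_nonneg_right (Φ.toFun_le_mul_der (hg0 x)) hx.le
      _ ≤ g x * (A * (1 / (δ * ω x))) * ω x :=
          mul_le_mul_of_nonneg_right (mul_le_mul_of_nonneg_left h1 (hg0 x)) hx.le
      _ = A / δ * g x := by field_simp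
  have hupt : ENNReal.ofReal (A / δ) * (ENNReal.ofReal a * volume (ball c r)) < ⊤ :=
    ENNReal.mul_lt_top ENNReal.ofReal_lt_top (ENNReal.mul_lt_top ENNReal.ofReal_lt_top
      hVt.lt_top)
  have hlow : ENNReal.ofReal (Φ.toFun a) * ∫⁻ x in ball c r, ENNReal.ofReal (ω x) ≤
      ∫⁻ x, Φ.toFunE (maximalFn v x) * ENNReal.ofReal (ω x) := by
    rw [← lintegral_const_mul' _ _ ENNReal.ofReal_ne_top]
    refine (setLIntegral_mono' measurableSet_ball fun x hx => ?_).trans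
      (setLIntegral_le_lintegral _ _)
    refine mul_le_mul' ?_ le_rfl
    rw [← Φ.toFunE_ofReal ha, ← hak]
    refine Φ.monotone_toFunE (le_trans (le_of_eq ?_) (le_maximalFn v hr hx))
    rw [setLAverage_eq, setLAverage_eq]
    congr 1
    exact setLIntegral_congr_fun measurableSet_ball fun y hy => by
      simp only [hva y hy, hg]
  have h1 := hlow.trans ((H v hvm (hup.trans_lt hupt)).trans (mul_le_mul' le_rfl hup))
  set W := (⨍⁻ x in ball c r, ENNReal.ofReal (ω x) ∂volume).toReal with hW
  have hWE : ∫⁻ x in ball c r, ENNReal.ofReal (ω x) = ENNReal.ofReal W * volume (ball c r) := by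
    rw [hW, ENNReal.ofReal_toReal (laverage_ball_ofReal_ne_top hloc c hr), setLAverage_eq,
      ENNReal.div_mul_cancel hV0 hVt]
  have hW0 : 0 ≤ W := ENNReal.toReal_nonneg
  rw [hWE, ← mul_assoc, ← mul_assoc, ← mul_assoc, ENNReal.mul_le_mul_iff_left hV0 hVt,
    ← ENNReal.ofReal_mul (Φ.toFun_nonneg ha), ← ENNReal.ofReal_mul hC.le,
    ← ENNReal.ofReal_mul (by positivity), ENNReal.ofReal_le_ofReal_iff (by positivity)] at h1
  calc δ * W * Φ.toFun a = δ * (Φ.toFun a * W) := by ring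
    _ ≤ δ * (C * (A / δ) * a) := mul_le_mul_of_nonneg_left h1 hδ.le
    _ = C * A * a := by field_simp

lemma ModularMaximalBound.memAPhi {C : ℝ} (hC : 0 < C) (H : ModularMaximalBound Φ ω C)
    (hΦ : Delta2On Φ.toFun) (hω : Measurable ω) (hpos : ∀ x, 0 < ω x)
    (hloc : LocallyIntegrable ω volume) : MemAPhi Φ ω := by
  obtain ⟨A, hA1, hΦA⟩ := Φ.exists_der_invDer_le hΦ
  obtain ⟨A', hA'1, hΦA'⟩ := Φ.exists_der_le_const_mul hΦ 2
  obtain ⟨K, hK, hΦK⟩ := hΦ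
  have hA0 : 0 < A := by linarith
  have hA'0 : 0 < A' := by linarith
  set D := C * A * K with hD
  have hD0 : 0 < D := by positivity
  refine ⟨ENNReal.ofReal (A' * D), ENNReal.ofReal_ne_top, fun δ hδ c r hr => ?_⟩
  have hV0 : volume (ball c r) ≠ 0 := (measure_ball_pos volume c hr).ne'
  have hVt : volume (ball c r) ≠ ⊤ := measure_ball_lt_top.ne
  have hWt := laverage_ball_ofReal_ne_top hloc c hr
  set W := (⨍⁻ x in ball c r, ENNReal.ofReal (ω x) ∂volume).toReal with hW
  have hW0 : 0 < W := ENNReal.toReal_pos (laverage_ball_ofReal_ne_zero hω hpos c hr) hWt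
  set f : 𝔼 → ℝ := fun x => Φ.invDer (1 / (δ * ω x)) with hf
  have hfm : Measurable f :=
    Φ.monotone_invDer.measurable.comp (measurable_const.div (measurable_const.mul hω))
  have key : ∀ y, 0 ≤ y → ENNReal.ofReal y < ⨍⁻ x in ball c r, ENNReal.ofReal (f x) ∂volume →
      δ * W * Φ.der y ≤ D := by
    intro y hy0 hy
    have hlim : Tendsto (fun k : ℕ => ∫⁻ x in ball c r, ENNReal.ofReal (min (f x) k)) atTop
        (nhds (∫⁻ x in ball c r, ENNReal.ofReal (f x))) := by
      refine lintegral_tendsto_of_tendsto_of_monotone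
        (fun k => (hfm.min measurable_const).ennreal_ofReal.aemeasurable)
        (Eventually.of_forall fun x k m hkm => ?_) (Eventually.of_forall fun x => ?_)
      · exact ENNReal.ofReal_le_ofReal (min_le_min_left _ (by exact_mod_cast hkm))
      · refine tendsto_const_nhds.congr' ?_
        filter_upwards [eventually_ge_atTop ⌈f x⌉₊] with k hk
        rw [min_eq_left ((Nat.le_ceil _).trans (by exact_mod_cast hk))]
    rw [setLAverage_eq, ENNReal.lt_div_iff_mul_lt (Or.inl hV0) (Or.inl hVt)] at hy
    obtain ⟨k, hk⟩ := (hlim.eventually_const_lt hy).exists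
    rw [← ENNReal.lt_div_iff_mul_lt (Or.inl hV0) (Or.inl hVt), ← setLAverage_eq] at hk
    have hat : ⨍⁻ x in ball c r, ENNReal.ofReal (min (f x) k) ∂volume ≠ ⊤ := by
      rw [setLAverage_eq]
      refine ENNReal.div_ne_top (ne_top_of_le_ne_top (b := ∫⁻ x in ball c r, ENNReal.ofReal k)
        ?_ (lintegral_mono fun x => ENNReal.ofReal_le_ofReal (min_le_right _ _))) hV0
      rw [setLIntegral_const]
      exact ENNReal.mul_ne_top ENNReal.ofReal_ne_top hVt
    set a := (⨍⁻ x in ball c r, ENNReal.ofReal (min (f x) k) ∂volume).toReal with ha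
    have haE := (ENNReal.ofReal_toReal hat).symm
    rw [← ha] at haE
    rw [haE] at hk
    have hya : y < a := (ENNReal.ofReal_lt_ofReal_iff_of_nonneg hy0).1 hk
    have ha0 : 0 < a := hy0.trans_lt hya
    have h1 := H.mul_toFun_le hC hω hpos hloc hA0 hΦA hδ c hr k ha0.le haE
    have h2 : a * Φ.der a ≤ K * Φ.toFun a := (Φ.mul_der_le_toFun ha0.le).trans (hΦK a ha0.le)
    have h3 : a * (δ * W * Φ.der a) ≤ a * D := by
      calc a * (δ * W * Φ.der a) = δ * W * (a * Φ.der a) := by ring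
        _ ≤ δ * W * (K * Φ.toFun a) := by gcongr
        _ = K * (δ * W * Φ.toFun a) := by ring
        _ ≤ K * (C * A * a) := by gcongr
        _ = a * D := by rw [hD]; ring
    refine le_trans ?_ (le_of_mul_le_mul_left h3 ha0)
    exact mul_le_mul_of_nonneg_left (Φ.der_le_der hy0 hya.le) (by positivity)
  have hft : ⨍⁻ x in ball c r, ENNReal.ofReal (f x) ∂volume ≠ ⊤ := by
    intro htop
    obtain ⟨y, hy1, hy0⟩ := ((Φ.der_tendsto.eventually_gt_atTop (D / (δ * W))).and
      (eventually_ge_atTop 0)).exists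
    have h1 := key y hy0 (by rw [htop]; exact ENNReal.ofReal_lt_top)
    rw [div_lt_iff₀ (by positivity)] at hy1
    linarith
  rw [NFunction.derE, if_neg hft, laverage_const_mul hδ, ← ENNReal.ofReal_toReal hWt, ← hW,
    ← ENNReal.ofReal_mul hδ.le, ← ENNReal.ofReal_mul (by positivity)]
  refine ENNReal.ofReal_le_ofReal ?_
  set a := (⨍⁻ x in ball c r, ENNReal.ofReal (f x) ∂volume).toReal with ha
  have ha0 : 0 ≤ a := ENNReal.toReal_nonneg
  rcases ha0.eq_or_lt with ha0 | ha0
  · rw [← ha0, Φ.der_zero, mul_zero]; positivity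
  · have h1 := key (a / 2) (by positivity) (by
      rw [← ENNReal.ofReal_toReal hft, ← ha, ENNReal.ofReal_lt_ofReal_iff ha0]
      linarith)
    have h2 := hΦA' a (a / 2) ha0.le (by positivity) (by linarith)
    calc δ * W * Φ.der a ≤ δ * W * (A' * Φ.der (a / 2)) := by gcongr
      _ = A' * (δ * W * Φ.der (a / 2)) := by ring
      _ ≤ A' * D := by gcongr

end ModularToAPhi

/-! ### Muckenhoupt weights: openness and the weak type estimate -/

section Muckenhoupt

variable {n : ℕ} {ω : EuclideanSpace ℝ (Fin n) → ℝ}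

local notation "𝔼" => EuclideanSpace ℝ (Fin n)

/-- The class `A_p` is open on the left. -/
lemma MemMuckenhoupt.exists_lt {p : ℝ} (hp : 1 < p) (hω : Measurable ω) (hpos : ∀ x, 0 < ω x)
    (h : MemMuckenhoupt p ω) : ∃ q, 1 < q ∧ q < p ∧ MemMuckenhoupt q ω := by
  obtain ⟨C', hC't, hC'⟩ := h
  have hp1 : 0 < p - 1 := by linarith
  set C := C'.toReal + 1 with hCdef
  have hC0 : 0 < C := by positivity
  have hCC : C' ≤ ENNReal.ofReal C := by
    rw [← ENNReal.ofReal_toReal hC't]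
    exact ENNReal.ofReal_le_ofReal (by linarith)
  set κ : ℝ := (1 / 2) ^ (n + 1) with hκ
  have hκ0 : 0 < κ := by positivity
  set L := (2 * C / κ) ^ (1 / (p - 1)) with hL
  have hL0 : 0 < L := by positivity
  obtain ⟨ε, hε, hRH⟩ := exists_reverseHolder n (θ := κ / (4 * L)) (by positivity)
  set σ : 𝔼 → ℝ := fun x => ω x ^ (-(1 / (p - 1))) with hσdef
  have hσ : Measurable σ := hω.pow_const _
  have hσ0 : ∀ x, 0 ≤ σ x := fun x => Real.rpow_nonneg (hpos x).le _
  have hσE : ∀ x, ENNReal.ofReal (ω x) ^ (-(1 / (p - 1))) = ENNReal.ofReal (σ x) := fun x =>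
    ENNReal.ofReal_rpow_of_pos (hpos x)
  simp_rw [hσE] at hC'
  have havt : ∀ c r, 0 < r → ⨍⁻ x in ball c r, ENNReal.ofReal (σ x) ∂volume ≠ ⊤ := by
    intro c r hr htop
    have h1 := hC' c r hr
    rw [htop, ENNReal.top_rpow_of_pos hp1,
      ENNReal.mul_top (laverage_ball_ofReal_ne_zero hω hpos c hr)] at h1
    exact hC't (top_le_iff.1 h1)
  have hfin : ∀ c r, (volume.withDensity fun x => ENNReal.ofReal (σ x)) (ball c r) < ⊤ := by
    intro c r
    rcases le_or_gt r 0 with hr | hr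
    · simp [ball_eq_empty.2 hr]
    · rw [withDensity_apply _ measurableSet_ball, lt_top_iff_ne_top]
      intro htop
      refine havt c r hr ?_
      rw [setLAverage_eq, htop, ENNReal.top_div_of_ne_top measure_ball_lt_top.ne]
  have hlarge := largeSubsetBound_of_duality (φ := fun s => s ^ (p - 1))
    (fun a ha b _ hab => Real.rpow_le_rpow ha hab hp1.le) (fun t ht => Real.rpow_pos_of_pos ht _)
    hC0 hκ0 hL0 (fun a b ha hb hab => by
      have h1 := Real.rpow_le_rpow (by positivity) hab (by positivity : 0 ≤ 1 / (p - 1))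
      rwa [Real.mul_rpow (by positivity) (by positivity), ← Real.rpow_mul ha, ← Real.rpow_mul hb,
        mul_one_div_cancel hp1.ne', Real.rpow_one, Real.rpow_one] at h1) hσ hσ0 hpos
    (fun x => by
      change 1 ≤ ω x * (ω x ^ (-(1 / (p - 1)))) ^ (p - 1)
      rw [← Real.rpow_mul (hpos x).le, neg_mul, one_div_mul_cancel hp1.ne', Real.rpow_neg_one,
        mul_inv_cancel₀ (hpos x).ne']) hfin
    (fun c r hr => by
      refine le_trans (le_of_eq ?_) ((hC' c r hr).trans hCC)
      rw [← ENNReal.ofReal_rpow_of_nonneg ENNReal.toReal_nonneg hp1.le,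
        ENNReal.ofReal_toReal (havt c r hr)])
  have hε1 : 0 < 1 + ε := by linarith
  have hq1 : 0 < (p - 1) / (1 + ε) := by positivity
  refine ⟨1 + (p - 1) / (1 + ε), by linarith, ?_, 2 ^ ((p - 1) / (1 + ε)) * C', ?_,
    fun c r hr => ?_⟩
  · have : (p - 1) / (1 + ε) < p - 1 := div_lt_self hp1 (by linarith)
    linarith
  · exact ENNReal.mul_ne_top (ENNReal.rpow_ne_top_of_nonneg hq1.le (by norm_num)) hC't
  · have hrh := hRH σ hσ hσ0 hfin hlarge c r hr
    rw [add_sub_cancel_left]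
    have hpow : ∀ x, ENNReal.ofReal (ω x) ^ (-(1 / ((p - 1) / (1 + ε)))) =
        ENNReal.ofReal (σ x ^ (1 + ε)) := by
      intro x
      rw [ENNReal.ofReal_rpow_of_pos (hpos x), hσdef]
      simp only
      rw [← Real.rpow_mul (hpos x).le]
      congr 2
      field_simp
    simp_rw [hpow]
    calc _ ≤ (⨍⁻ x in ball c r, ENNReal.ofReal (ω x) ∂volume) *
          (2 * (⨍⁻ x in ball c r, ENNReal.ofReal (σ x) ∂volume) ^ (1 + ε)) ^
            ((p - 1) / (1 + ε)) := by gcongr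
      _ = 2 ^ ((p - 1) / (1 + ε)) * ((⨍⁻ x in ball c r, ENNReal.ofReal (ω x) ∂volume) *
          (⨍⁻ x in ball c r, ENNReal.ofReal (σ x) ∂volume) ^ (p - 1)) := by
        rw [ENNReal.mul_rpow_of_nonneg _ _ hq1.le, ← ENNReal.rpow_mul,
          mul_div_cancel₀ _ hε1.ne']
        ring
      _ ≤ _ := mul_le_mul' le_rfl (hC' c r hr)

/-- Hölder's inequality against a Muckenhoupt weight. -/
lemma laverage_rpow_mul_measure_le {q : ℝ} (hq : 1 < q) (hω : Measurable ω)
    (hpos : ∀ x, 0 < ω x) {C : ℝ≥0∞}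
    (H : ∀ (c : 𝔼) (r : ℝ), 0 < r → (⨍⁻ x in ball c r, ENNReal.ofReal (ω x) ∂volume) *
      (⨍⁻ x in ball c r, ENNReal.ofReal (ω x) ^ (-(1 / (q - 1))) ∂volume) ^ (q - 1) ≤ C)
    {f : 𝔼 → ℝ≥0∞} (hf : Measurable f) (c : 𝔼) {r : ℝ} (hr : 0 < r) :
    (⨍⁻ x in ball c r, f x ∂volume) ^ q *
        (volume.withDensity fun x => ENNReal.ofReal (ω x)) (ball c r) ≤
      C * ∫⁻ x in ball c r, f x ^ q ∂(volume.withDensity fun x => ENNReal.ofReal (ω x)) := by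
  have hV0 : volume (ball c r) ≠ 0 := (measure_ball_pos volume c hr).ne'
  have hVt : volume (ball c r) ≠ ⊤ := measure_ball_lt_top.ne
  have hq0 : 0 < q := by linarith
  have hq1 : 0 < q - 1 := by linarith
  have hconj : q.HolderConjugate (q / (q - 1)) := Real.HolderConjugate.conjExponent hq
  have hωE : Measurable fun x => ENNReal.ofReal (ω x) := hω.ennreal_ofReal
  have hω0 : ∀ x, ENNReal.ofReal (ω x) ≠ 0 := fun x => (ENNReal.ofReal_pos.2 (hpos x)).ne'
  have hhol := ENNReal.lintegral_mul_le_Lp_mul_Lq (volume.restrict (ball c r)) hconj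
    (f := fun x => f x * ENNReal.ofReal (ω x) ^ (1 / q))
    (g := fun x => ENNReal.ofReal (ω x) ^ (-(1 / q)))
    (hf.mul (hωE.pow_const _)).aemeasurable (hωE.pow_const _).aemeasurable
  have e1 : ∫⁻ x in ball c r, ((fun x => f x * ENNReal.ofReal (ω x) ^ (1 / q)) *
      fun x => ENNReal.ofReal (ω x) ^ (-(1 / q))) x = ∫⁻ x in ball c r, f x := by
    refine lintegral_congr fun x => ?_
    simp only [Pi.mul_apply]
    rw [mul_assoc, ← ENNReal.rpow_add _ _ (hω0 x) ENNReal.ofReal_ne_top, add_neg_cancel,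
      ENNReal.rpow_zero, mul_one]
  have e2 : ∫⁻ x in ball c r, (f x * ENNReal.ofReal (ω x) ^ (1 / q)) ^ q =
      ∫⁻ x in ball c r, f x ^ q ∂(volume.withDensity fun x => ENNReal.ofReal (ω x)) := by
    rw [restrict_withDensity measurableSet_ball,
      lintegral_withDensity_eq_lintegral_mul _ hωE (hf.pow_const q)]
    refine lintegral_congr fun x => ?_
    simp only [Pi.mul_apply]
    rw [ENNReal.mul_rpow_of_nonneg _ _ hq0.le, ← ENNReal.rpow_mul, one_div_mul_cancel hq0.ne',
      ENNReal.rpow_one, mul_comm]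
  have e3 : ∫⁻ x in ball c r, (ENNReal.ofReal (ω x) ^ (-(1 / q))) ^ (q / (q - 1)) =
      ∫⁻ x in ball c r, ENNReal.ofReal (ω x) ^ (-(1 / (q - 1))) := by
    refine lintegral_congr fun x => ?_
    rw [← ENNReal.rpow_mul]
    congr 1
    field_simp
  rw [e1, e2, e3] at hhol
  set I := ∫⁻ x in ball c r, f x ^ q ∂(volume.withDensity fun x => ENNReal.ofReal (ω x))
  set J := ∫⁻ x in ball c r, ENNReal.ofReal (ω x) ^ (-(1 / (q - 1))) with hJ
  set V := volume (ball c r) with hV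
  have h1 := ENNReal.rpow_le_rpow hhol hq0.le
  rw [ENNReal.mul_rpow_of_nonneg _ _ hq0.le, ← ENNReal.rpow_mul, ← ENNReal.rpow_mul,
    one_div_mul_cancel hq0.ne', ENNReal.rpow_one,
    show 1 / (q / (q - 1)) * q = q - 1 by field_simp] at h1
  have h2 := H c r hr
  rw [setLAverage_eq, setLAverage_eq, ← hJ, ← hV,
    ← withDensity_apply _ measurableSet_ball] at h2
  rw [setLAverage_eq, ← hV]
  set ν := (volume.withDensity fun x => ENNReal.ofReal (ω x)) (ball c r)
  calc ((∫⁻ x in ball c r, f x) / V) ^ q * ν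
      = (∫⁻ x in ball c r, f x) ^ q * ν * (V⁻¹) ^ q := by
        rw [div_eq_mul_inv, ENNReal.mul_rpow_of_nonneg _ _ hq0.le]
        ring
    _ ≤ I * J ^ (q - 1) * ν * (V⁻¹) ^ q := by gcongr
    _ = ν / V * (J / V) ^ (q - 1) * I := by
        rw [div_eq_mul_inv, div_eq_mul_inv, ENNReal.mul_rpow_of_nonneg _ _ hq1.le]
        have : (V⁻¹) ^ q = V⁻¹ * (V⁻¹) ^ (q - 1) := by
          conv_rhs => rw [← ENNReal.rpow_one V⁻¹]
          rw [← ENNReal.rpow_mul, one_mul,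
            ← ENNReal.rpow_add _ _ (ENNReal.inv_ne_zero.2 hVt) (ENNReal.inv_ne_top.2 hV0),
            add_sub_cancel]
        rw [this]
        ring
    _ ≤ C * I := by gcongr

/-- Muckenhoupt weights are doubling. -/
lemma measure_ball_five_le {q : ℝ} (hq : 1 < q) (hω : Measurable ω)
    (hpos : ∀ x, 0 < ω x) {C : ℝ≥0∞}
    (H : ∀ (c : 𝔼) (r : ℝ), 0 < r → (⨍⁻ x in ball c r, ENNReal.ofReal (ω x) ∂volume) *
      (⨍⁻ x in ball c r, ENNReal.ofReal (ω x) ^ (-(1 / (q - 1))) ∂volume) ^ (q - 1) ≤ C)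
    (c : 𝔼) {r : ℝ} (hr : 0 < r) :
    (volume.withDensity fun x => ENNReal.ofReal (ω x)) (ball c (5 * r)) ≤
      ENNReal.ofReal (5 ^ n) ^ q * C *
        (volume.withDensity fun x => ENNReal.ofReal (ω x)) (ball c r) := by
  set W := volume.withDensity fun x => ENNReal.ofReal (ω x) with hW
  have hV0 : volume (ball c r) ≠ 0 := (measure_ball_pos volume c hr).ne'
  have hVt : volume (ball c r) ≠ ⊤ := measure_ball_lt_top.ne
  have hq0 : 0 < q := by linarith
  have hsub : ball c r ⊆ ball c (5 * r) := ball_subset_ball (by linarith)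
  have h1 := laverage_rpow_mul_measure_le hq hω hpos H
    (f := (ball c r).indicator fun _ => 1) (measurable_const.indicator measurableSet_ball) c
    (show 0 < 5 * r by positivity)
  have h5 : ENNReal.ofReal (5 ^ n) ≠ 0 := (ENNReal.ofReal_pos.2 (by positivity)).ne'
  have e1 : ⨍⁻ x in ball c (5 * r), (ball c r).indicator (fun _ => (1:ℝ≥0∞)) x ∂volume =
      (ENNReal.ofReal (5 ^ n))⁻¹ := by
    rw [setLAverage_eq, setLIntegral_indicator measurableSet_ball,
      Set.inter_eq_self_of_subset_left hsub, setLIntegral_one,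
      volume_ball_mul c c (by norm_num : (0:ℝ) < 5), div_eq_mul_inv,
      ENNReal.mul_inv (Or.inl h5) (Or.inl ENNReal.ofReal_ne_top), mul_left_comm,
      ENNReal.mul_inv_cancel hV0 hVt, mul_one]
  have e2 : ∫⁻ x in ball c (5 * r), (ball c r).indicator (fun _ => (1:ℝ≥0∞)) x ^ q ∂W =
      W (ball c r) := by
    have : ∀ x, (ball c r).indicator (fun _ => (1:ℝ≥0∞)) x ^ q =
        (ball c r).indicator (fun _ => (1:ℝ≥0∞)) x := by
      intro x
      by_cases hx : x ∈ ball c r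
      · rw [Set.indicator_of_mem hx, ENNReal.one_rpow]
      · rw [Set.indicator_of_notMem hx, ENNReal.zero_rpow_of_pos hq0]
    simp_rw [this]
    rw [setLIntegral_indicator measurableSet_ball, Set.inter_eq_self_of_subset_left hsub,
      setLIntegral_one]
  rw [e1, ← hW, e2, ENNReal.inv_rpow] at h1
  calc W (ball c (5 * r)) = ENNReal.ofReal (5 ^ n) ^ q *
        ((ENNReal.ofReal (5 ^ n) ^ q)⁻¹ * W (ball c (5 * r))) := by
        rw [← mul_assoc, ENNReal.mul_inv_cancel, one_mul]
        · exact (ENNReal.rpow_pos (pos_iff_ne_zero.2 h5) ENNReal.ofReal_ne_top).ne'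
        · exact ENNReal.rpow_ne_top_of_nonneg hq0.le ENNReal.ofReal_ne_top
    _ ≤ ENNReal.ofReal (5 ^ n) ^ q * (C * W (ball c r)) := by gcongr
    _ = _ := by rw [mul_assoc]

/-- Weak type `(q, q)` estimate for the maximal function. -/
lemma MemMuckenhoupt.exists_weakType {q : ℝ} (hq : 1 < q) (hω : Measurable ω)
    (hpos : ∀ x, 0 < ω x) (h : MemMuckenhoupt q ω) :
    ∃ D : ℝ≥0∞, D ≠ ⊤ ∧ ∀ g : 𝔼 → ℝ, Measurable g → ∀ s : ℝ≥0∞,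
      s ^ q * (volume.withDensity fun x => ENNReal.ofReal (ω x)) {x | s < maximalFn g x} ≤
        D * ∫⁻ x, ENNReal.ofReal |g x| ^ q ∂(volume.withDensity fun x => ENNReal.ofReal (ω x)) := by
  obtain ⟨C, hCt, H⟩ := h
  have hq0 : 0 < q := by linarith
  set W := volume.withDensity fun x => ENNReal.ofReal (ω x) with hW
  set D := ENNReal.ofReal (5 ^ n) ^ q * C with hD
  refine ⟨D * C, ENNReal.mul_ne_top (ENNReal.mul_ne_top (ENNReal.rpow_ne_top_of_nonneg hq0.le
    ENNReal.ofReal_ne_top) hCt) hCt, fun g hg s => ?_⟩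
  set I := ∫⁻ x, ENNReal.ofReal |g x| ^ q ∂W with hI
  have hgm : Measurable fun x => ENNReal.ofReal |g x| := hg.abs.ennreal_ofReal
  set S : ℕ → Set 𝔼 := fun N => {x | ∃ (c : 𝔼) (r : ℝ), 0 < r ∧ r ≤ N ∧ x ∈ ball c r ∧
    s < ⨍⁻ y in ball c r, ENNReal.ofReal |g y| ∂volume} with hS
  have hSU : {x | s < maximalFn g x} ⊆ ⋃ N, S N := by
    intro x hx
    have hx' : s < maximalFn g x := hx
    simp only [maximalFn, lt_iSup_iff] at hx'
    obtain ⟨c, r, hr, hlt⟩ := hx'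
    exact Set.mem_iUnion.2 ⟨⌈r⌉₊, c, r, hr.1, Nat.le_ceil _, hr.2, hlt⟩
  have hSmono : Monotone S := fun N M hNM x ⟨c, r, h1, h2, h3⟩ =>
    ⟨c, r, h1, h2.trans (by exact_mod_cast hNM), h3⟩
  have hSN : ∀ N, s ^ q * W (S N) ≤ D * C * I := by
    intro N
    set T : Set (𝔼 × ℝ) := {a | 0 < a.2 ∧ a.2 ≤ N ∧
      s < ⨍⁻ y in ball a.1 a.2, ENNReal.ofReal |g y| ∂volume} with hT
    obtain ⟨u, huT, hdisj, hcov⟩ := Vitali.exists_disjoint_subfamily_covering_enlargement_ball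
      T Prod.fst Prod.snd N (fun a ha => ha.2.1) 5 (by norm_num)
    have hucount : u.Countable := hdisj.countable_of_isOpen (fun _ _ => isOpen_ball)
      fun a ha => ⟨a.1, mem_ball_self (huT ha).1⟩
    have hsingle : ∀ a ∈ u, s ^ q * W (ball a.1 (5 * a.2)) ≤
        D * C * ∫⁻ x in ball a.1 a.2, ENNReal.ofReal |g x| ^ q ∂W := by
      intro a ha
      have hT := huT ha
      calc s ^ q * W (ball a.1 (5 * a.2))
          ≤ s ^ q * (D * W (ball a.1 a.2)) :=
            mul_le_mul' le_rfl (measure_ball_five_le hq hω hpos H a.1 hT.1)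
        _ = D * (s ^ q * W (ball a.1 a.2)) := mul_left_comm _ _ _
        _ ≤ D * ((⨍⁻ y in ball a.1 a.2, ENNReal.ofReal |g y| ∂volume) ^ q * W (ball a.1 a.2)) := by
            have := hT.2.2.le
            gcongr
        _ ≤ D * (C * ∫⁻ x in ball a.1 a.2, ENNReal.ofReal |g x| ^ q ∂W) :=
            mul_le_mul' le_rfl (laverage_rpow_mul_measure_le hq hω hpos H hgm a.1 hT.1)
        _ = _ := (mul_assoc _ _ _).symm
    calc s ^ q * W (S N) ≤ s ^ q * W (⋃ a ∈ u, ball a.1 (5 * a.2)) := by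
          refine mul_le_mul' le_rfl (measure_mono ?_)
          rintro x ⟨c, r, h1, h2, h3, h4⟩
          obtain ⟨b, hb, hsub⟩ := hcov (c, r) ⟨h1, h2, h4⟩
          exact Set.mem_biUnion hb (hsub h3)
      _ ≤ s ^ q * ∑' a : u, W (ball a.1.1 (5 * a.1.2)) :=
          mul_le_mul' le_rfl (measure_biUnion_le _ hucount _)
      _ = ∑' a : u, s ^ q * W (ball a.1.1 (5 * a.1.2)) := ENNReal.tsum_mul_left.symm
      _ ≤ ∑' a : u, D * C * ∫⁻ x in ball a.1.1 a.1.2, ENNReal.ofReal |g x| ^ q ∂W :=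
          ENNReal.tsum_le_tsum fun a => hsingle a a.2
      _ = D * C * ∑' a : u, ∫⁻ x in ball a.1.1 a.1.2, ENNReal.ofReal |g x| ^ q ∂W :=
          ENNReal.tsum_mul_left
      _ = D * C * ∫⁻ x in ⋃ a ∈ u, ball a.1 a.2, ENNReal.ofReal |g x| ^ q ∂W := by
          rw [lintegral_biUnion hucount (fun _ _ => measurableSet_ball) hdisj]
      _ ≤ _ := mul_le_mul' le_rfl (setLIntegral_le_lintegral _ _)
  calc s ^ q * W {x | s < maximalFn g x} ≤ s ^ q * W (⋃ N, S N) :=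
        mul_le_mul' le_rfl (measure_mono hSU)
    _ = ⨆ N, s ^ q * W (S N) := by rw [hSmono.measure_iUnion, ENNReal.mul_iSup]
    _ ≤ _ := iSup_le hSN

end Muckenhoupt

/-! ### From `A_{i(Φ)}` to the modular maximal inequality -/

lemma NFunction.tendsto_toFun_atTop (Φ : NFunction) : Tendsto Φ.toFun atTop atTop := by
  refine tendsto_atTop_mono' atTop ?_ (Φ.der_tendsto.comp (tendsto_id.atTop_div_const two_pos))
  filter_upwards [eventually_ge_atTop 2] with t ht
  have h1 := Φ.mul_der_le_toFun (t := t / 2) (by linarith)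
  rw [mul_div_cancel₀ t two_ne_zero] at h1
  refine le_trans ?_ h1
  exact le_mul_of_one_le_left (Φ.der_nonneg _) (by linarith)

/-- Hardy type bound for the derivative of an `N`-function below its lower index. -/
lemma NFunction.exists_lintegral_rpow_mul_der_le (Φ : NFunction) (hΦ : Delta2On Φ.toFun) {q : ℝ}
    (hq0 : 0 < q) (hq : q < Φ.lowerIndex) :
    ∃ C, 0 < C ∧ ∀ u, 0 < u →
      ∫⁻ t in Set.Ioc 0 (2 * u), ENNReal.ofReal ((t / 2) ^ (-q) * Φ.der t) ≤
        ENNReal.ofReal (C * (Φ.toFun u * u ^ (-q))) := by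
  obtain ⟨q', hqq', hq'⟩ := exists_between hq
  obtain ⟨C₁, hC₁, hC₁Φ⟩ := Φ.exists_toFun_mul_le_rpow hΦ (hq0.trans hqq').le hq'
  obtain ⟨K, hK, hΦK⟩ := hΦ
  have hε : 0 < q' - q := sub_pos.2 hqq'
  refine ⟨K ^ 2 * C₁ / (q' - q), by positivity, fun u hu => ?_⟩
  set w := 2 * u with hw
  have hw0 : 0 < w := by positivity
  have hΦu := Φ.toFun_pos hu
  have hpt : ∀ t ∈ Set.Ioc 0 w, ENNReal.ofReal ((t / 2) ^ (-q) * Φ.der t) ≤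
      ENNReal.ofReal (2 ^ q * K ^ 2 * C₁ * w ^ (-q') * Φ.toFun u) *
        ENNReal.ofReal (t ^ (q' - q - 1)) := by
    intro t ht
    have ht0 : 0 < t := ht.1
    rw [← ENNReal.ofReal_mul (by positivity)]
    refine ENNReal.ofReal_le_ofReal ?_
    have h1 : t * Φ.der t ≤ K * Φ.toFun t := (Φ.mul_der_le_toFun ht0.le).trans (hΦK t ht0.le)
    have h2 := hC₁Φ (t / w) w (by positivity) ((div_le_one hw0).2 ht.2) hw0
    rw [div_mul_cancel₀ _ hw0.ne'] at h2
    have h3 : Φ.toFun w ≤ K * Φ.toFun u := hΦK u hu.le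
    have h4 : Φ.der t ≤ K * (C₁ * (t / w) ^ q' * (K * Φ.toFun u)) / t := by
      rw [le_div_iff₀ ht0, mul_comm]
      refine h1.trans (mul_le_mul_of_nonneg_left (h2.trans ?_) hK.le)
      gcongr
    calc (t / 2) ^ (-q) * Φ.der t
        ≤ (t / 2) ^ (-q) * (K * (C₁ * (t / w) ^ q' * (K * Φ.toFun u)) / t) := by gcongr
      _ = _ := by
        rw [Real.div_rpow ht0.le zero_le_two, Real.div_rpow ht0.le hw0.le,
          Real.rpow_neg zero_le_two, Real.rpow_neg hw0.le, Real.rpow_neg ht0.le,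
          Real.rpow_sub_one ht0.ne', Real.rpow_sub ht0]
        have := Real.rpow_pos_of_pos ht0 q
        have := Real.rpow_pos_of_pos hw0 q'
        have := Real.rpow_pos_of_pos (zero_lt_two' ℝ) q
        field_simp
  refine (setLIntegral_mono' measurableSet_Ioc hpt).trans (le_of_eq ?_)
  rw [lintegral_const_mul' _ _ ENNReal.ofReal_ne_top, lintegral_rpow_Ioc_zero hw0.le hε,
    ← ENNReal.ofReal_mul (by positivity)]
  congr 1
  rw [Real.rpow_sub hw0, Real.rpow_neg hw0.le, Real.rpow_neg hu.le]
  have h5 : w ^ q = 2 ^ q * u ^ q := by rw [hw, Real.mul_rpow zero_le_two hu.le]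
  rw [h5]
  have := Real.rpow_pos_of_pos hu q
  have := Real.rpow_pos_of_pos hw0 q'
  have := Real.rpow_pos_of_pos (zero_lt_two' ℝ) q
  field_simp

section ApToModular

variable {n : ℕ} {Φ : NFunction} {ω : EuclideanSpace ℝ (Fin n) → ℝ}

local notation "𝔼" => EuclideanSpace ℝ (Fin n)

lemma measurable_maximalFn (g : 𝔼 → ℝ) : Measurable (maximalFn g) := by
  refine measurable_of_Ioi fun s => IsOpen.measurableSet ?_
  rw [isOpen_iff_mem_nhds]
  intro x hx
  have hx' : s < maximalFn g x := hx
  simp only [maximalFn, lt_iSup_iff] at hx'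
  obtain ⟨c, r, hr, hlt⟩ := hx'
  filter_upwards [isOpen_ball.mem_nhds hr.2] with y hy
  exact hlt.trans_le (le_maximalFn g hr.1 hy)

/-- Only the part of `v` above height `s` matters for the level set of `Mv` at height `2s`. -/
lemma lt_maximalFn_indicator {v : 𝔼 → ℝ} {s : ℝ} (hs : 0 < s) {x : 𝔼}
    (hx : ENNReal.ofReal (2 * s) < maximalFn v x) :
    ENNReal.ofReal s < maximalFn ({y | s < |v y|}.indicator v) x := by
  simp only [maximalFn, lt_iSup_iff] at hx
  obtain ⟨c, r, hr, hlt⟩ := hx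
  refine lt_of_lt_of_le ?_ (le_maximalFn _ hr.1 hr.2)
  have hV0 : volume (ball c r) ≠ 0 := (measure_ball_pos volume c hr.1).ne'
  have hVt : volume (ball c r) ≠ ⊤ := measure_ball_lt_top.ne
  have h1 : ⨍⁻ y in ball c r, ENNReal.ofReal |v y| ∂volume ≤ ENNReal.ofReal s +
      ⨍⁻ y in ball c r, ENNReal.ofReal |{y | s < |v y|}.indicator v y| ∂volume := by
    calc ⨍⁻ y in ball c r, ENNReal.ofReal |v y| ∂volume
        ≤ (∫⁻ y in ball c r, (ENNReal.ofReal s +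
          ENNReal.ofReal |{y | s < |v y|}.indicator v y|)) / volume (ball c r) := by
          rw [setLAverage_eq]
          refine ENNReal.div_le_div_right (lintegral_mono fun y => ?_) _
          by_cases hy : s < |v y|
          · rw [Set.indicator_of_mem (show y ∈ {y | s < |v y|} from hy)]
            exact le_add_self
          · exact le_add_right (ENNReal.ofReal_le_ofReal (not_lt.1 hy))
      _ = _ := by
          rw [lintegral_add_left measurable_const, setLIntegral_const, ENNReal.add_div,
            mul_div_assoc, ENNReal.div_self hV0 hVt, mul_one, setLAverage_eq]
  have h2 := hlt.trans_le h1
  rw [two_mul, ENNReal.ofReal_add hs.le hs.le] at h2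
  exact (ENNReal.add_lt_add_iff_left ENNReal.ofReal_ne_top).1 h2

/-- Modular bound for truncations of the maximal function. -/
lemma lintegral_toFun_min_maximalFn_le {q : ℝ} (hq0 : 0 < q)
    {W : Measure 𝔼} [SFinite W] {D C : ℝ} (hD : 0 < D)
    (hweak : ∀ g : 𝔼 → ℝ, Measurable g → ∀ s : ℝ≥0∞,
      s ^ q * W {x | s < maximalFn g x} ≤ ENNReal.ofReal D * ∫⁻ x, ENNReal.ofReal |g x| ^ q ∂W)
    (hC : 0 < C) (hHardy : ∀ u, 0 < u →
      ∫⁻ t in Set.Ioc 0 (2 * u), ENNReal.ofReal ((t / 2) ^ (-q) * Φ.der t) ≤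
        ENNReal.ofReal (C * (Φ.toFun u * u ^ (-q))))
    {v : 𝔼 → ℝ} (hv : Measurable v) (N : ℕ) :
    ∫⁻ x, ENNReal.ofReal (Φ.toFun (min (maximalFn v x) N).toReal) ∂W ≤
      ENNReal.ofReal (D * C) * ∫⁻ x, ENNReal.ofReal (Φ.toFun |v x|) ∂W := by
  set f : 𝔼 → ℝ := fun x => (min (maximalFn v x) N).toReal with hf
  have hfm : Measurable f := ((measurable_maximalFn v).min measurable_const).ennreal_toReal
  have hf0 : ∀ x, 0 ≤ f x := fun x => ENNReal.toReal_nonneg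
  have hlevel : ∀ t, 0 < t → W {x | t < f x} ≤ ENNReal.ofReal (D * (t / 2) ^ (-q)) *
      ∫⁻ x, {x | t < 2 * |v x|}.indicator (fun x => ENNReal.ofReal (|v x| ^ q)) x ∂W := by
    intro t ht
    have hs : 0 < t / 2 := by positivity
    have hsub : {x | t < f x} ⊆
        {x | ENNReal.ofReal (t / 2) < maximalFn ({y | t / 2 < |v y|}.indicator v) x} := by
      intro x hx
      refine lt_maximalFn_indicator hs ?_
      rw [mul_div_cancel₀ t two_ne_zero]
      have hx' : t < (min (maximalFn v x) N).toReal := hx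
      refine lt_of_lt_of_le ?_ (min_le_left _ (N : ℝ≥0∞))
      exact (ENNReal.ofReal_lt_iff_lt_toReal ht.le
        (ne_top_of_le_ne_top (ENNReal.natCast_ne_top N) (min_le_right _ _))).2 hx'
    have hw := hweak ({y | t / 2 < |v y|}.indicator v)
      (hv.indicator (measurableSet_lt measurable_const hv.abs)) (ENNReal.ofReal (t / 2))
    have hInteg : ∫⁻ x, ENNReal.ofReal |{y | t / 2 < |v y|}.indicator v x| ^ q ∂W =
        ∫⁻ x, {x | t < 2 * |v x|}.indicator (fun x => ENNReal.ofReal (|v x| ^ q)) x ∂W := by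
      refine lintegral_congr fun x => ?_
      by_cases hx : t < 2 * |v x|
      · rw [Set.indicator_of_mem (show x ∈ {x | t < 2 * |v x|} from hx),
          Set.indicator_of_mem (show x ∈ {y | t / 2 < |v y|} from by
            change t / 2 < |v x|; linarith),
          ENNReal.ofReal_rpow_of_nonneg (abs_nonneg _) hq0.le]
      · rw [Set.indicator_of_notMem (show x ∉ {x | t < 2 * |v x|} from hx),
          Set.indicator_of_notMem (show x ∉ {y | t / 2 < |v y|} from fun h => hx (by
            have h' : t / 2 < |v x| := h
            linarith)), abs_zero, ENNReal.ofReal_zero, ENNReal.zero_rpow_of_pos hq0]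
    rw [hInteg, ENNReal.ofReal_rpow_of_pos hs] at hw
    set I := ∫⁻ x, {x | t < 2 * |v x|}.indicator (fun x => ENNReal.ofReal (|v x| ^ q)) x ∂W
    have hsq : 0 < (t / 2) ^ q := by positivity
    calc W {x | t < f x} ≤ _ := measure_mono hsub
      _ = ENNReal.ofReal ((t / 2) ^ (-q)) * (ENNReal.ofReal ((t / 2) ^ q) *
          W {x | ENNReal.ofReal (t / 2) < maximalFn ({y | t / 2 < |v y|}.indicator v) x}) := by
          rw [← mul_assoc, ← ENNReal.ofReal_mul (by positivity), Real.rpow_neg hs.le,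
            inv_mul_cancel₀ hsq.ne', ENNReal.ofReal_one, one_mul]
      _ ≤ ENNReal.ofReal ((t / 2) ^ (-q)) * (ENNReal.ofReal D * I) := mul_le_mul' le_rfl hw
      _ = _ := by rw [← mul_assoc, ← ENNReal.ofReal_mul (by positivity), mul_comm D]
  have hlayer : ∫⁻ x, ENNReal.ofReal (Φ.toFun (f x)) ∂W =
      ∫⁻ t in Set.Ioi 0, W {x | t < f x} * ENNReal.ofReal (Φ.der t) :=
    lintegral_comp_eq_lintegral_meas_lt_mul W (Eventually.of_forall hf0) hfm.aemeasurable
      (fun t ht => intervalIntegrable_of_monotoneOn_Ici Φ.der_mono le_rfl ht.le)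
      (Eventually.of_forall fun t => Φ.der_nonneg t)
  set G : ℝ → 𝔼 → ℝ≥0∞ := fun t x =>
    {p : ℝ × 𝔼 | p.1 < 2 * |v p.2|}.indicator (fun p => ENNReal.ofReal (|v p.2| ^ q) *
      ENNReal.ofReal ((p.1 / 2) ^ (-q) * Φ.der (max p.1 0))) (t, x) with hG
  have hGm : Measurable (Function.uncurry G) := by
    refine Measurable.indicator ?_ (measurableSet_lt measurable_fst
      ((hv.comp measurable_snd).abs.const_mul 2))
    exact ((hv.comp measurable_snd).abs.pow_const q).ennreal_ofReal.mul
      (((measurable_fst.div_const 2).pow_const (-q)).mul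
        (Φ.measurable_der_max.comp measurable_fst)).ennreal_ofReal
  have hGt : ∀ t ∈ Set.Ioi (0:ℝ), W {x | t < f x} * ENNReal.ofReal (Φ.der t) ≤
      ENNReal.ofReal D * ∫⁻ x, G t x ∂W := by
    intro t ht
    have ht0 : 0 < t := ht
    refine (mul_le_mul' (hlevel t ht) le_rfl).trans (le_of_eq ?_)
    rw [ENNReal.ofReal_mul hD.le, mul_assoc, mul_assoc, mul_comm (lintegral _ _), ← mul_assoc
      (ENNReal.ofReal ((t / 2) ^ (-q))), ← ENNReal.ofReal_mul (by positivity),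
      ← lintegral_const_mul' _ _ ENNReal.ofReal_ne_top]
    congr 1
    refine lintegral_congr fun x => ?_
    simp only [hG]
    by_cases hx : t < 2 * |v x|
    · rw [Set.indicator_of_mem (show x ∈ {x | t < 2 * |v x|} from hx),
        Set.indicator_of_mem (show (t, x) ∈ {p : ℝ × 𝔼 | p.1 < 2 * |v p.2|} from hx),
        max_eq_left ht0.le, mul_comm]
    · rw [Set.indicator_of_notMem (show x ∉ {x | t < 2 * |v x|} from hx),
        Set.indicator_of_notMem (show (t, x) ∉ {p : ℝ × 𝔼 | p.1 < 2 * |v p.2|} from hx), mul_zero]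
  have hGx : ∀ x, ∫⁻ t in Set.Ioi 0, G t x ≤
      ENNReal.ofReal C * ENNReal.ofReal (Φ.toFun |v x|) := by
    intro x
    set u := |v x| with hu
    have hu0 : 0 ≤ u := abs_nonneg _
    have h1 : ∫⁻ t in Set.Ioi 0, G t x ≤ ENNReal.ofReal (u ^ q) *
        ∫⁻ t in Set.Ioc 0 (2 * u), ENNReal.ofReal ((t / 2) ^ (-q) * Φ.der t) := by
      rw [← lintegral_const_mul' _ _ ENNReal.ofReal_ne_top, ← lintegral_indicator
        measurableSet_Ioi, ← lintegral_indicator measurableSet_Ioc]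
      refine lintegral_mono fun t => ?_
      by_cases ht : t ∈ Set.Ioi (0:ℝ)
      · rw [Set.indicator_of_mem ht]
        simp only [hG]
        by_cases hx : t < 2 * u
        · rw [Set.indicator_of_mem (show (t, x) ∈ {p : ℝ × 𝔼 | p.1 < 2 * |v p.2|} from hx),
            Set.indicator_of_mem (show t ∈ Set.Ioc 0 (2 * u) from ⟨ht, hx.le⟩),
            max_eq_left (le_of_lt ht)]
        · rw [Set.indicator_of_notMem (show (t, x) ∉ {p : ℝ × 𝔼 | p.1 < 2 * |v p.2|} from hx)]
          exact zero_le
      · rw [Set.indicator_of_notMem ht]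
        exact zero_le
    refine h1.trans ?_
    rcases hu0.eq_or_lt with hu0 | hu0
    · rw [← hu0, Real.zero_rpow hq0.ne', ENNReal.ofReal_zero, zero_mul]
      exact zero_le
    · refine (mul_le_mul' le_rfl (hHardy u hu0)).trans (le_of_eq ?_)
      rw [← ENNReal.ofReal_mul (by positivity), ← ENNReal.ofReal_mul hC.le,
        Real.rpow_neg hu0.le]
      congr 1
      have := Real.rpow_pos_of_pos hu0 q
      field_simp
  calc ∫⁻ x, ENNReal.ofReal (Φ.toFun (f x)) ∂W
      ≤ ∫⁻ t in Set.Ioi 0, ENNReal.ofReal D * ∫⁻ x, G t x ∂W := by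
        rw [hlayer]
        exact setLIntegral_mono' measurableSet_Ioi hGt
    _ = ENNReal.ofReal D * ∫⁻ x, (∫⁻ t in Set.Ioi (0:ℝ), G t x) ∂W := by
        rw [lintegral_const_mul' _ _ ENNReal.ofReal_ne_top,
          lintegral_lintegral_swap hGm.aemeasurable]
    _ ≤ ENNReal.ofReal D * ∫⁻ x, ENNReal.ofReal C * ENNReal.ofReal (Φ.toFun |v x|) ∂W :=
        mul_le_mul' le_rfl (lintegral_mono hGx)
    _ = _ := by
        rw [lintegral_const_mul' _ _ ENNReal.ofReal_ne_top, ← mul_assoc,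
          ← ENNReal.ofReal_mul hD.le]

lemma MemMuckenhoupt.exists_modularMaximalBound (hΦ : Delta2On Φ.toFun) (hΦc : Delta2On Φ.conj)
    (hω : Measurable ω) (hpos : ∀ x, 0 < ω x) (h : MemMuckenhoupt Φ.lowerIndex ω) :
    ∃ C, 0 < C ∧ ModularMaximalBound Φ ω C := by
  obtain ⟨q, hq1, hqp, hq⟩ := h.exists_lt (Φ.one_lt_lowerIndex hΦ hΦc) hω hpos
  have hq0 : 0 < q := by linarith
  obtain ⟨D', hD't, hweak⟩ := hq.exists_weakType hq1 hω hpos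
  obtain ⟨C, hC, hHardy⟩ := Φ.exists_lintegral_rpow_mul_der_le hΦ hq0 hqp
  set D := D'.toReal + 1 with hD
  have hD0 : 0 < D := by positivity
  have hDD : D' ≤ ENNReal.ofReal D := by
    rw [← ENNReal.ofReal_toReal hD't]
    exact ENNReal.ofReal_le_ofReal (by linarith)
  refine ⟨D * C, by positivity, fun v hv _ => ?_⟩
  set W := volume.withDensity fun x => ENNReal.ofReal (ω x) with hW
  have hωE : Measurable fun x => ENNReal.ofReal (ω x) := hω.ennreal_ofReal
  have hMm := measurable_maximalFn v
  have hm1 : Measurable fun x => Φ.toFunE (maximalFn v x) :=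
    Φ.monotone_toFunE.measurable.comp hMm
  have hm2 : Measurable fun x => ENNReal.ofReal (Φ.toFun |v x|) :=
    (Φ.continuous_toFun_abs.measurable.comp hv).ennreal_ofReal
  have e1 : ∫⁻ x, Φ.toFunE (maximalFn v x) * ENNReal.ofReal (ω x) =
      ∫⁻ x, Φ.toFunE (maximalFn v x) ∂W := by
    rw [hW, lintegral_withDensity_eq_lintegral_mul _ hωE hm1]
    exact lintegral_congr fun x => mul_comm _ _
  have e2 : ∫⁻ x, ENNReal.ofReal (Φ.toFun |v x|) * ENNReal.ofReal (ω x) =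
      ∫⁻ x, ENNReal.ofReal (Φ.toFun |v x|) ∂W := by
    rw [hW, lintegral_withDensity_eq_lintegral_mul _ hωE hm2]
    exact lintegral_congr fun x => mul_comm _ _
  rw [e1, e2]
  have hE : ∀ (N : ℕ) x, ENNReal.ofReal (Φ.toFun (min (maximalFn v x) N).toReal) =
      Φ.toFunE (min (maximalFn v x) N) := fun N x => by
    rw [NFunction.toFunE, if_neg (ne_top_of_le_ne_top (ENNReal.natCast_ne_top N)
      (min_le_right _ _))]
  have hlim : Tendsto (fun N : ℕ => ∫⁻ x, Φ.toFunE (min (maximalFn v x) N) ∂W) atTop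
      (nhds (∫⁻ x, Φ.toFunE (maximalFn v x) ∂W)) := by
    refine lintegral_tendsto_of_tendsto_of_monotone
      (fun N => (Φ.monotone_toFunE.measurable.comp (hMm.min measurable_const)).aemeasurable)
      (Eventually.of_forall fun x N M hNM => ?_) (Eventually.of_forall fun x => ?_)
    · exact Φ.monotone_toFunE (min_le_min_left _ (by exact_mod_cast hNM))
    · by_cases hx : maximalFn v x = ⊤
      · simp only [hx, min_eq_right le_top]
        have h1 : Φ.toFunE ⊤ = ⊤ := if_pos rfl
        have h2 : ∀ N : ℕ, Φ.toFunE N = ENNReal.ofReal (Φ.toFun N) := fun N => by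
          rw [← Φ.toFunE_ofReal N.cast_nonneg, ENNReal.ofReal_natCast]
        simp_rw [h1, h2]
        exact ENNReal.tendsto_ofReal_atTop.comp
          (Φ.tendsto_toFun_atTop.comp tendsto_natCast_atTop_atTop)
      · obtain ⟨N₀, hN₀⟩ := ENNReal.exists_nat_gt hx
        refine tendsto_const_nhds.congr' ?_
        filter_upwards [eventually_ge_atTop N₀] with N hN
        rw [min_eq_left (hN₀.le.trans (by exact_mod_cast hN))]
  refine le_of_tendsto' hlim fun N => ?_
  simp_rw [← hE]
  exact lintegral_toFun_min_maximalFn_le hq0 hD0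
    (fun g hg s => (hweak g hg s).trans (mul_le_mul' hDD le_rfl)) hC hHardy hv N

end ApToModular

/-! ### Changing the weight on a null set -/

section Representative

variable {n : ℕ} {Φ : NFunction} {ω ω' : EuclideanSpace ℝ (Fin n) → ℝ}

lemma setLAverage_congr_comp (F : ℝ → ℝ≥0∞) (h : ω =ᵐ[volume] ω')
    (s : Set (EuclideanSpace ℝ (Fin n))) :
    ⨍⁻ x in s, F (ω x) ∂volume = ⨍⁻ x in s, F (ω' x) ∂volume :=
  laverage_congr (ae_restrict_of_ae (h.fun_comp F))

lemma memAPhi_congr (h : ω =ᵐ[volume] ω') : MemAPhi Φ ω ↔ MemAPhi Φ ω' := by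
  refine exists_congr fun C => and_congr_right fun _ => forall₂_congr fun δ _ =>
    forall₃_congr fun c r _ => ?_
  rw [setLAverage_congr_comp (fun y => ENNReal.ofReal (δ * y)) h,
    setLAverage_congr_comp (fun y => ENNReal.ofReal (Φ.invDer (1 / (δ * y)))) h]

lemma memMuckenhoupt_congr {p : ℝ} (h : ω =ᵐ[volume] ω') :
    MemMuckenhoupt p ω ↔ MemMuckenhoupt p ω' := by
  unfold MemMuckenhoupt
  simp_rw [setLAverage_congr_comp ENNReal.ofReal h,
    setLAverage_congr_comp (fun y => ENNReal.ofReal y ^ (-(1 / (p - 1)))) h]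

lemma modularMaximalBound_congr {C : ℝ} (h : ω =ᵐ[volume] ω') :
    ModularMaximalBound Φ ω C ↔ ModularMaximalBound Φ ω' C := by
  have key : ∀ g : EuclideanSpace ℝ (Fin n) → ℝ≥0∞,
      ∫⁻ x, g x * ENNReal.ofReal (ω x) = ∫⁻ x, g x * ENNReal.ofReal (ω' x) := fun g =>
    lintegral_congr_ae (h.mono fun x hx => by simp only [hx])
  unfold ModularMaximalBound
  simp_rw [key]

lemma IsWeight.exists_measurable_pos (hω : IsWeight ω) :
    ∃ ω' : EuclideanSpace ℝ (Fin n) → ℝ, ω =ᵐ[volume] ω' ∧ Measurable ω' ∧ (∀ x, 0 < ω' x) ∧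
      LocallyIntegrable ω' volume := by
  have hm := hω.1.aestronglyMeasurable
  have hmk : Measurable (hm.mk ω) := hm.stronglyMeasurable_mk.measurable
  have hae : ω =ᵐ[volume] fun x => if 0 < hm.mk ω x then hm.mk ω x else 1 := by
    filter_upwards [hm.ae_eq_mk, hω.2] with x hx hpos
    rw [← hx, if_pos hpos]
  refine ⟨_, hae, hmk.ite (measurableSet_lt measurable_const hmk) measurable_const,
    fun x => ?_, hω.1.congr hae⟩
  split_ifs with hx
  exacts [hx, one_pos]

end Representative

/-- characterization of the class `A_Φ`: membership in `A_{i(Φ)}` and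
modular continuity of the Hardy–Littlewood maximal operator. -/
theorem APhi_tfae {n : ℕ} (Φ : NFunction)
    (hΦ : Delta2On Φ.toFun) (hΦc : Delta2On Φ.conj)
    (ω : EuclideanSpace ℝ (Fin n) → ℝ) (hω : IsWeight ω) :
    List.TFAE
      [MemAPhi Φ ω,
       MemMuckenhoupt Φ.lowerIndex ω,
       ∃ C : ℝ, 0 < C ∧ ∀ v : EuclideanSpace ℝ (Fin n) → ℝ, Measurable v →
         (∫⁻ x, ENNReal.ofReal (Φ.toFun |v x|) * ENNReal.ofReal (ω x) < ⊤) →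
         ∫⁻ x, Φ.toFunE (maximalFn v x) * ENNReal.ofReal (ω x) ≤
           ENNReal.ofReal C * ∫⁻ x, ENNReal.ofReal (Φ.toFun |v x|) * ENNReal.ofReal (ω x)] := by
  obtain ⟨ω', hae, hm, hpos, hloc⟩ := hω.exists_measurable_pos
  change List.TFAE [_, _, ∃ C : ℝ, 0 < C ∧ ModularMaximalBound Φ ω C]
  simp_rw [memAPhi_congr hae, memMuckenhoupt_congr hae, modularMaximalBound_congr hae]
  tfae_have 1 → 2 := fun h => h.memMuckenhoupt hΦ hΦc hm hpos hloc
  tfae_have 2 → 3 := fun h => h.exists_modularMaximalBound hΦ hΦc hm hpos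
  tfae_have 3 → 1 := fun ⟨_, hC, H⟩ => H.memAPhi hC hΦ hm hpos hloc
  tfae_finish
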